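/- The set of nonzero nilpotent hypermatrices in V (those nonzero T ∈ V such that 0 lies in the closure of the G-orbit of T) is a union of G-orbits, and it decomposes into exactly 145 distinct G-orbits. -/

import Mathlib

/-- The space of real 2×2×2×2 hypermatrices. -/
abbrev V : Type := Fin 2 → Fin 2 → Fin 2 → Fin 2 → ℝ

/-- The group `SL₂(ℝ)⁴`. -/
abbrev G : Type :=
  Matrix.SpecialLinearGroup (Fin 2) ℝ × Matrix.SpecialLinearGroup (Fin 2) ℝ ×
    Matrix.SpecialLinearGroup (Fin 2) ℝ × Matrix.SpecialLinearGroup (Fin 2) ℝ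

/-- The natural linear action of `G = SL₂(ℝ)⁴` on `V`. -/
noncomputable def actG (g : G) (T : V) : V := fun i₁ i₂ i₃ i₄ =>
  ∑ j₁ : Fin 2, ∑ j₂ : Fin 2, ∑ j₃ : Fin 2, ∑ j₄ : Fin 2,
    (g.1 : Matrix (Fin 2) (Fin 2) ℝ) i₁ j₁ * (g.2.1 : Matrix (Fin 2) (Fin 2) ℝ) i₂ j₂ *
      (g.2.2.1 : Matrix (Fin 2) (Fin 2) ℝ) i₃ j₃ * (g.2.2.2 : Matrix (Fin 2) (Fin 2) ℝ) i₄ j₄ *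
      T j₁ j₂ j₃ j₄

/-- The `G`-orbit of a hypermatrix. -/
def orbitG (T : V) : Set V := {S | ∃ g : G, actG g T = S}

namespace Hypermatrix

open Matrix

/-- The entry of a hypermatrix at a multi-index. -/
def coord (T : V) (i : Fin 4 → Fin 2) : ℝ := T (i 0) (i 1) (i 2) (i 3)

/-- The hypermatrix with prescribed entries. -/
def ofCoord (f : (Fin 4 → Fin 2) → ℝ) : V := fun a b c d => f ![a, b, c, d]

/-- Permutation of the four tensor factors. -/
def perm (e : Equiv.Perm (Fin 4)) (T : V) : V := ofCoord fun i => coord T (i ∘ e)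

/-- The four matrices of an element of `G`. -/
def factor (g : G) : Fin 4 → Matrix (Fin 2) (Fin 2) ℝ :=
  ![(g.1 : Matrix (Fin 2) (Fin 2) ℝ), g.2.1, g.2.2.1, g.2.2.2]

/-- The element of `G` with prescribed factors. -/
def ofFactor (h : Fin 4 → Matrix.SpecialLinearGroup (Fin 2) ℝ) : G := (h 0, h 1, h 2, h 3)

lemma vec_eq {α : Type*} (i : Fin 4 → α) : ![i 0, i 1, i 2, i 3] = i := by
  ext k; fin_cases k <;> rfl

@[simp] lemma coord_ofCoord (f : (Fin 4 → Fin 2) → ℝ) : coord (ofCoord f) = f := by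
  ext i; simp only [coord, ofCoord, vec_eq]

@[simp] lemma ofCoord_coord (T : V) : ofCoord (coord T) = T := rfl

lemma coord_injective : Function.Injective coord := fun S T h => by
  rw [← ofCoord_coord S, h, ofCoord_coord]

lemma coord_perm (e : Equiv.Perm (Fin 4)) (T : V) (i : Fin 4 → Fin 2) :
    coord (perm e T) i = coord T (i ∘ e) := by
  simp [perm]

lemma perm_perm (e e' : Equiv.Perm (Fin 4)) (T : V) :
    perm e (perm e' T) = perm (e * e') T := by
  apply coord_injective; ext i
  simp only [coord_perm]; rfl

@[simp] lemma perm_one (T : V) : perm 1 T = T := by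
  apply coord_injective; ext i
  simp only [coord_perm]; rfl

/-- Multi-indices as quadruples. -/
def quadEquiv : (Fin 2 × Fin 2 × Fin 2 × Fin 2) ≃ (Fin 4 → Fin 2) where
  toFun p := ![p.1, p.2.1, p.2.2.1, p.2.2.2]
  invFun i := (i 0, i 1, i 2, i 3)
  left_inv _ := rfl
  right_inv i := vec_eq i

lemma coord_actG (g : G) (T : V) (i : Fin 4 → Fin 2) :
    coord (actG g T) i = ∑ j : Fin 4 → Fin 2, (∏ k, factor g k (i k) (j k)) * coord T j := by
  rw [← quadEquiv.sum_comp]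
  simp only [Fintype.sum_prod_type, coord, actG, factor, Fin.prod_univ_four, quadEquiv]
  rfl

@[simp] lemma factor_ofFactor (h : Fin 4 → Matrix.SpecialLinearGroup (Fin 2) ℝ) (k : Fin 4) :
    factor (ofFactor h) k = (h k : Matrix (Fin 2) (Fin 2) ℝ) := by
  fin_cases k <;> rfl

lemma factor_mul (g h : G) (k : Fin 4) : factor (g * h) k = factor g k * factor h k := by
  fin_cases k <;> rfl

lemma actG_mul (g h : G) (T : V) : actG (g * h) T = actG g (actG h T) := by
  apply coord_injective; ext i
  simp only [coord_actG, factor_mul, Matrix.mul_apply, Finset.prod_univ_sum,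
    Fintype.piFinset_univ, Finset.mul_sum, Finset.sum_mul, Finset.prod_mul_distrib]
  rw [Finset.sum_comm]
  simp only [mul_assoc]

lemma actG_one (T : V) : actG 1 T = T := by
  ext a b c d
  simp [actG, Matrix.one_apply]

/-- Equivalence of hypermatrices under `G`. -/
def Equ (S T : V) : Prop := ∃ g : G, actG g S = T

namespace Equ

lemma refl (T : V) : Equ T T := ⟨1, actG_one T⟩

lemma trans {R S T : V} : Equ R S → Equ S T → Equ R T := by
  rintro ⟨g, rfl⟩ ⟨h, rfl⟩
  exact ⟨h * g, actG_mul h g R⟩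

lemma symm {S T : V} : Equ S T → Equ T S := by
  rintro ⟨g, rfl⟩
  exact ⟨g⁻¹, by rw [← actG_mul, inv_mul_cancel, actG_one]⟩

lemma of_eq {S T : V} (h : S = T) : Equ S T := h ▸ refl S

end Equ

lemma perm_actG (e : Equiv.Perm (Fin 4)) (h : Fin 4 → Matrix.SpecialLinearGroup (Fin 2) ℝ)
    (T : V) : perm e (actG (ofFactor h) T) = actG (ofFactor (h ∘ e.symm)) (perm e T) := by
  apply coord_injective; ext i
  simp only [coord_perm, coord_actG, factor_ofFactor, Function.comp_apply]
  refine Fintype.sum_equiv (Equiv.arrowCongr e (Equiv.refl (Fin 2))) _ _ fun j => ?_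
  congr 1
  · refine Fintype.prod_equiv e _ _ fun k => ?_
    simp [Equiv.arrowCongr]
  · congr 1
    ext k
    simp [Equiv.arrowCongr]

lemma ofFactor_surjective : Function.Surjective ofFactor := fun g =>
  ⟨![g.1, g.2.1, g.2.2.1, g.2.2.2], rfl⟩

lemma Equ.perm {S T : V} (e : Equiv.Perm (Fin 4)) : Equ S T → Equ (perm e S) (perm e T) := by
  rintro ⟨g, rfl⟩
  obtain ⟨h, rfl⟩ := ofFactor_surjective g
  exact ⟨_, (perm_actG e h S).symm⟩

lemma orbitG_eq_iff {S T : V} : orbitG S = orbitG T ↔ Equ S T := by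
  constructor
  · intro h
    have : T ∈ orbitG S := h ▸ Equ.refl T
    exact this
  · intro h
    ext R
    exact ⟨fun hR => h.symm.trans hR, fun hR => h.trans hR⟩

/-! ### Action on a single tensor factor -/

/-- The special linear matrix with rows `(p, q)` and `(r, s)`. -/
def sl (p q r s : ℝ) (h : p * s - q * r = 1) : Matrix.SpecialLinearGroup (Fin 2) ℝ :=
  ⟨!![p, q; r, s], by rw [Matrix.det_fin_two_of, h]⟩

section single

variable (T : V) {p q r s : ℝ}

lemma equ_fst (h : p * s - q * r = 1) : Equ T fun a b c d =>
    ![p * T 0 b c d + q * T 1 b c d, r * T 0 b c d + s * T 1 b c d] a := by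
  refine ⟨(sl p q r s h, 1, 1, 1), ?_⟩
  ext a b c d
  fin_cases a <;> simp [actG, Matrix.one_apply, sl]

lemma equ_snd (h : p * s - q * r = 1) : Equ T fun a b c d =>
    ![p * T a 0 c d + q * T a 1 c d, r * T a 0 c d + s * T a 1 c d] b := by
  refine ⟨(1, sl p q r s h, 1, 1), ?_⟩
  ext a b c d
  fin_cases b <;> simp [actG, Matrix.one_apply, sl]

lemma equ_trd (h : p * s - q * r = 1) : Equ T fun a b c d =>
    ![p * T a b 0 d + q * T a b 1 d, r * T a b 0 d + s * T a b 1 d] c := by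
  refine ⟨(1, 1, sl p q r s h, 1), ?_⟩
  ext a b c d
  fin_cases c <;> simp [actG, Matrix.one_apply, sl]

lemma equ_fth (h : p * s - q * r = 1) : Equ T fun a b c d =>
    ![p * T a b c 0 + q * T a b c 1, r * T a b c 0 + s * T a b c 1] d := by
  refine ⟨(1, 1, 1, sl p q r s h), ?_⟩
  ext a b c d
  fin_cases d <;> simp [actG, Matrix.one_apply, sl]

end single

/-- The signs of a multi-index: `1` at `0` and `-1` at `1`. -/
def weight (l : Fin 4 → ℝ) (i : Fin 4 → Fin 2) : ℝ := ∑ k, ![l k, -l k] (i k)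

/-- The diagonal matrix with entries `exp l` and `exp (-l)`. -/
noncomputable def slExp (l : ℝ) : Matrix.SpecialLinearGroup (Fin 2) ℝ :=
  sl (Real.exp l) 0 0 (Real.exp (-l)) (by rw [← Real.exp_add]; simp)

lemma slExp_apply (l : ℝ) (a b : Fin 2) :
    slExp l a b = if a = b then Real.exp (![l, -l] a) else 0 := by
  fin_cases a <;> fin_cases b <;> simp [slExp, sl]

lemma coord_actG_slExp (l : Fin 4 → ℝ) (T : V) (i : Fin 4 → Fin 2) :
    coord (actG (ofFactor fun k => slExp (l k)) T) i = Real.exp (weight l i) * coord T i := by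
  rw [coord_actG, Finset.sum_eq_single i]
  · simp only [factor_ofFactor, slExp_apply, if_true, weight, Real.exp_sum]
  · intro j _ hj
    obtain ⟨k, hk⟩ := Function.ne_iff.1 hj
    rw [Finset.prod_eq_zero (Finset.mem_univ k), zero_mul]
    rw [factor_ofFactor, slExp_apply, if_neg (Ne.symm hk)]
  · simp

lemma equ_scale (l : Fin 4 → ℝ) (f : (Fin 4 → Fin 2) → ℝ) :
    Equ (ofCoord f) (ofCoord fun i => Real.exp (weight l i) * f i) := by
  refine ⟨ofFactor fun k => slExp (l k), coord_injective ?_⟩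
  ext i
  rw [coord_actG_slExp, coord_ofCoord, coord_ofCoord]

lemma equ_neg (T : V) : Equ T (-T) := by
  refine (equ_fst T (p := -1) (q := 0) (r := 0) (s := -1) (by norm_num)).trans (.of_eq ?_)
  ext a b c d
  fin_cases a <;> simp

/-! ### Normal forms -/

/-- The hypermatrix supported on the multi-indices with exactly one `1`. -/
noncomputable def wForm (c : Fin 4 → ℝ) : V :=
  ofCoord fun i => ∑ k, if ∀ j, i j = 1 ↔ j = k then c k else 0

/-- The sum of `c k` times the basis hypermatrices at the set of all `j ≠ k` with `c j ≠ 0`. -/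
noncomputable def cForm (s : Fin 4 → SignType) : V :=
  ofCoord fun i => ∑ k, if ∀ j, i j = 1 ↔ s j ≠ 0 ∧ j ≠ k then ((s k : SignType) : ℝ) else 0

/-- The basis hypermatrix at the set of all `j` with `p j`. -/
noncomputable def unitForm (p : Fin 4 → Prop) [DecidablePred p] : V :=
  ofCoord fun i => if ∀ j, i j = 1 ↔ p j then 1 else 0

/-- The hypermatrix with the vectors `u k` in the factor `f`, placed at the multi-indices having
exactly one `1`, at `k`, in the remaining factors. -/
noncomputable def mForm (f : Fin 4) (u : Fin 4 → Fin 2 → ℝ) : V :=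
  ofCoord fun i => ∑ k, if k ≠ f ∧ ∀ j, j ≠ f → (i j = 1 ↔ j = k) then u k (i f) else 0

/-- Vectors realizing the prescribed signs of brackets. -/
noncomputable def signVec (h : Fin 4 → SignType) : Fin 4 → Fin 2 → ℝ :=
  ![![1, 0], ![0, (h 0 : ℝ)], ![(h 1 : ℝ), (h 2 : ℝ)], ![0, 0]]

/-- The kinds of normal forms. -/
inductive Kind
  | w | ghz | re | pair | tri | cross
  deriving DecidableEq

instance : Fintype Kind where
  elems := {.w, .ghz, .re, .pair, .tri, .cross}
  complete κ := by cases κ <;> decide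

/-- The first zero of a sign vector. -/
def zeroPos (s : Fin 4 → SignType) : Fin 4 :=
  if s 0 = 0 then 0 else if s 1 = 0 then 1 else if s 2 = 0 then 2 else 3

/-- The transposition moving the first zero of a sign vector to the last place. -/
def toLast (s : Fin 4 → SignType) : Equiv.Perm (Fin 4) := Equiv.swap (zeroPos s) 3

/-- The representatives of the nilpotent orbits. -/
noncomputable def rep : Kind → (Fin 4 → SignType) → V
  | .w, s => wForm fun k => (s k : ℝ)
  | .ghz, s => unitForm (fun _ => False) + unitForm (fun j => s j = 0)
  | .re, s => unitForm (fun _ => False) + cForm s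
  | .pair, s => wForm (fun k => (s k : ℝ)) + unitForm (fun j => s j = 0)
  | .tri, s => perm (toLast s) (mForm 3 (signVec (s ∘ toLast s)))
  | .cross, s => unitForm (fun j => s j = 0) + cForm s

/-- The number of nonzero signs. -/
def numNonzero (s : Fin 4 → SignType) : ℕ := (Finset.univ.filter fun k => s k ≠ 0).card

/-- The sign vectors that label normal forms of a given kind. -/
def Valid : Kind → (Fin 4 → SignType) → Prop
  | .w, s => numNonzero s ≠ 0
  | .ghz, s => numNonzero s = 1
  | .re, s => numNonzero s = 3 ∧ (∏ k, if s k = 0 then 1 else s k) = -1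
  | .pair, s => numNonzero s = 2
  | .tri, s => numNonzero s = 3
  | .cross, s => numNonzero s = 3

instance (κ : Kind) (s : Fin 4 → SignType) : Decidable (Valid κ s) := by
  cases κ <;> unfold Valid <;> infer_instance

lemma numNonzero_comp (s : Fin 4 → SignType) (e : Equiv.Perm (Fin 4)) :
    numNonzero (s ∘ e) = numNonzero s := by
  unfold numNonzero
  rw [← Finset.card_map e.toEmbedding]
  congr 1
  ext k
  simp

lemma Valid.comp {κ : Kind} {s : Fin 4 → SignType} (h : Valid κ s) (e : Equiv.Perm (Fin 4)) :
    Valid κ (s ∘ e) := by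
  cases κ <;> simp only [Valid, numNonzero_comp] at h ⊢
  case re => exact ⟨h.1, by rw [← h.2]; exact Fintype.prod_equiv e _ _ fun k => rfl⟩
  all_goals exact h

lemma perm_add (e : Equiv.Perm (Fin 4)) (S T : V) : perm e (S + T) = perm e S + perm e T := rfl

lemma perm_wForm (e : Equiv.Perm (Fin 4)) (c : Fin 4 → ℝ) :
    perm e (wForm c) = wForm (c ∘ e.symm) := by
  apply coord_injective; ext i
  simp only [coord_perm, wForm, coord_ofCoord, Function.comp_apply]
  refine Fintype.sum_equiv e _ _ fun k => ?_
  rw [Equiv.symm_apply_apply]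
  congr 1
  rw [eq_iff_iff, ← e.forall_congr_right (q := fun j => i j = 1 ↔ j = e k)]
  simp

lemma perm_cForm (e : Equiv.Perm (Fin 4)) (s : Fin 4 → SignType) :
    perm e (cForm s) = cForm (s ∘ e.symm) := by
  apply coord_injective; ext i
  simp only [coord_perm, cForm, coord_ofCoord, Function.comp_apply]
  refine Fintype.sum_equiv e _ _ fun k => ?_
  rw [Equiv.symm_apply_apply]
  congr 1
  rw [eq_iff_iff, ← e.forall_congr_right (q := fun j => i j = 1 ↔ s (e.symm j) ≠ 0 ∧ j ≠ e k)]
  simp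

lemma perm_unitForm (e : Equiv.Perm (Fin 4)) (p : Fin 4 → Prop) [DecidablePred p] :
    perm e (unitForm p) = unitForm fun j => p (e.symm j) := by
  apply coord_injective; ext i
  simp only [coord_perm, unitForm, coord_ofCoord, Function.comp_apply]
  congr 1
  rw [eq_iff_iff, ← e.forall_congr_right (q := fun j => i j = 1 ↔ p (e.symm j))]
  simp

lemma perm_mForm (e : Equiv.Perm (Fin 4)) (f : Fin 4) (u : Fin 4 → Fin 2 → ℝ) :
    perm e (mForm f u) = mForm (e f) (u ∘ e.symm) := by
  apply coord_injective; ext i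
  simp only [coord_perm, mForm, coord_ofCoord, Function.comp_apply]
  refine Fintype.sum_equiv e _ _ fun k => ?_
  rw [Equiv.symm_apply_apply]
  congr 1
  rw [eq_iff_iff, ← e.forall_congr_right (q := fun j => j ≠ e f → (i j = 1 ↔ j = e k))]
  simp

lemma perm_rep {κ : Kind} (hκ : κ ≠ .tri) (e : Equiv.Perm (Fin 4)) (s : Fin 4 → SignType) :
    perm e (rep κ s) = rep κ (s ∘ e.symm) := by
  cases κ
  case tri => exact absurd rfl hκ
  all_goals
    simp only [rep, perm_add, perm_wForm, perm_cForm, perm_unitForm, Function.comp_apply]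
    try rfl

/-- Two hypermatrices with the same signs, supported on four independent weights, are
equivalent. -/
lemma equ_of_sign (n : Fin 4 → Fin 4 → Fin 2)
    (hn : ∀ v : Fin 4 → ℝ, ∃ l : Fin 4 → ℝ, ∀ j, weight l (n j) = v j)
    {S T : V} (hS : ∀ i, (∀ j, n j ≠ i) → coord S i = 0)
    (hT : ∀ i, (∀ j, n j ≠ i) → coord T i = 0)
    (h : ∀ j, SignType.sign (coord S (n j)) = SignType.sign (coord T (n j))) : Equ S T := by
  obtain ⟨l, hl⟩ := hn fun j => Real.log |coord T (n j)| - Real.log |coord S (n j)|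
  have := equ_scale l (coord S)
  rw [ofCoord_coord] at this
  refine this.trans (.of_eq (coord_injective ?_))
  ext i
  rw [coord_ofCoord]
  by_cases hi : ∀ j, n j ≠ i
  · rw [hS i hi, hT i hi, mul_zero]
  · push Not at hi
    obtain ⟨j, rfl⟩ := hi
    rw [hl]
    by_cases hz : coord S (n j) = 0
    · have := h j
      rw [hz, sign_zero, eq_comm, sign_eq_zero_iff] at this
      rw [hz, this, mul_zero]
    · have hz' : coord T (n j) ≠ 0 := fun h0 => by
        have := h j
        rw [h0, sign_zero, sign_eq_zero_iff] at this
        exact hz this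
      have hpos := abs_pos.2 hz
      rw [Real.exp_sub, Real.exp_log (abs_pos.2 hz'), Real.exp_log hpos,
        div_mul_eq_mul_div, div_eq_iff hpos.ne']
      have hs := abs_mul_sign (coord S (n j))
      have ht := abs_mul_sign (coord T (n j))
      rw [← h j] at ht
      linear_combination |coord S (n j)| * ht - |coord T (n j)| * hs

/-- The hypermatrix with entries `v j` at the multi-indices `n j`. -/
noncomputable def sparse (n : Fin 4 → Fin 4 → Fin 2) (v : Fin 4 → ℝ) : V :=
  ofCoord fun i => ∑ j, if n j = i then v j else 0

/-- Four weights are independent. -/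
def IndepWeights (n : Fin 4 → Fin 4 → Fin 2) : Prop :=
  ∀ v : Fin 4 → ℝ, ∃ l : Fin 4 → ℝ, ∀ j, weight l (n j) = v j

lemma IndepWeights.injective {n : Fin 4 → Fin 4 → Fin 2} (h : IndepWeights n) :
    Function.Injective n := by
  intro j k hjk
  obtain ⟨l, hl⟩ := h (Pi.single j 1)
  by_contra hne
  have h1 := hl j
  have h2 := hl k
  rw [hjk, h2, Pi.single_eq_same, Pi.single_eq_of_ne (Ne.symm hne)] at h1
  exact zero_ne_one h1

lemma coord_sparse_self {n : Fin 4 → Fin 4 → Fin 2} (h : IndepWeights n) (v : Fin 4 → ℝ)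
    (j : Fin 4) : coord (sparse n v) (n j) = v j := by
  simp [sparse, h.injective.eq_iff]

lemma coord_sparse_of_ne {n : Fin 4 → Fin 4 → Fin 2} (v : Fin 4 → ℝ) {i : Fin 4 → Fin 2}
    (hi : ∀ j, n j ≠ i) : coord (sparse n v) i = 0 := by
  simp [sparse, hi]

lemma equ_sparse {n : Fin 4 → Fin 4 → Fin 2} (hn : IndepWeights n) {v w : Fin 4 → ℝ}
    (h : ∀ j, SignType.sign (v j) = SignType.sign (w j)) : Equ (sparse n v) (sparse n w) := by
  refine equ_of_sign n hn (fun i => coord_sparse_of_ne v) (fun i => coord_sparse_of_ne w)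
    fun j => ?_
  rw [coord_sparse_self hn, coord_sparse_self hn, h j]

lemma neg_sparse (n : Fin 4 → Fin 4 → Fin 2) (v : Fin 4 → ℝ) :
    -sparse n v = sparse n (-v) := by
  apply coord_injective; ext i
  change -coord (sparse n v) i = _
  simp only [sparse, coord_ofCoord, ← Finset.sum_neg_distrib, Pi.neg_apply]
  congr 1; ext j; split_ifs <;> simp

/-- Multi-indices of the form `w`. -/
def wIdx : Fin 4 → Fin 4 → Fin 2 := ![![1, 0, 0, 0], ![0, 1, 0, 0], ![0, 0, 1, 0], ![0, 0, 0, 1]]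
/-- Multi-indices of the form `pair`, completed to independent weights. -/
def pairIdx : Fin 4 → Fin 4 → Fin 2 :=
  ![![1, 0, 0, 0], ![0, 1, 0, 0], ![0, 0, 1, 1], ![0, 0, 1, 0]]
/-- Multi-indices of the form `cross`. -/
def crossIdx : Fin 4 → Fin 4 → Fin 2 :=
  ![![1, 0, 0, 0], ![0, 0, 1, 1], ![0, 1, 0, 1], ![0, 1, 1, 0]]
/-- Multi-indices of the form `re`. -/
def reIdx : Fin 4 → Fin 4 → Fin 2 :=
  ![![0, 0, 0, 0], ![0, 0, 1, 1], ![0, 1, 0, 1], ![0, 1, 1, 0]]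
/-- Multi-indices of the form `ghz`, completed to independent weights. -/
def ghzIdx : Fin 4 → Fin 4 → Fin 2 :=
  ![![0, 0, 0, 0], ![0, 1, 1, 1], ![0, 0, 1, 1], ![0, 1, 0, 1]]
/-- Multi-indices of the form `tri`. -/
def triIdx : Fin 4 → Fin 4 → Fin 2 :=
  ![![1, 0, 0, 0], ![0, 1, 0, 1], ![0, 0, 1, 0], ![0, 0, 1, 1]]

lemma indep_wIdx : IndepWeights wIdx := fun v => by
  let t := (v 0 + v 1 + v 2 + v 3) / 2
  refine ⟨![(t - v 0) / 2, (t - v 1) / 2, (t - v 2) / 2, (t - v 3) / 2], fun j => ?_⟩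
  fin_cases j <;> simp [weight, wIdx, Fin.sum_univ_four, t] <;> ring

lemma indep_pairIdx : IndepWeights pairIdx := fun v => by
  let p := v 2 + (v 0 + v 1) / 2
  let m := (v 1 - v 0) / 2
  let r := (v 0 + v 1) / 2
  refine ⟨![(p + m) / 2, (p - m) / 2, (r - (v 3 - p)) / 2, (r + (v 3 - p)) / 2], fun j => ?_⟩
  fin_cases j <;> simp [weight, pairIdx, Fin.sum_univ_four, p, m, r] <;> ring

lemma indep_crossIdx : IndepWeights crossIdx := fun v => by
  refine ⟨![(v 0 + v 1 + v 2 + v 3) / 2, (v 0 + v 1) / 2, (v 0 + v 2) / 2, (v 0 + v 3) / 2],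
    fun j => ?_⟩
  fin_cases j <;> simp [weight, crossIdx, Fin.sum_univ_four] <;> ring

lemma indep_reIdx : IndepWeights reIdx := fun v => by
  let t := (v 0 + v 1 + v 2 + v 3) / 4
  refine ⟨![t, (v 0 + v 1) / 2 - t, (v 0 + v 2) / 2 - t, (v 0 + v 3) / 2 - t], fun j => ?_⟩
  fin_cases j <;> simp [weight, reIdx, Fin.sum_univ_four, t] <;> ring

lemma indep_ghzIdx : IndepWeights ghzIdx := fun v => by
  let t := (v 0 + v 1) / 2
  refine ⟨![t, (v 0 + v 2) / 2 - t, (v 0 + v 3) / 2 - t,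
    t - (v 2 + v 3) / 2 + (v 0 - v 1) / 2 - (v 0 - t)], fun j => ?_⟩
  fin_cases j <;> simp [weight, ghzIdx, Fin.sum_univ_four, t] <;> ring

lemma indep_triIdx : IndepWeights triIdx := fun v => by
  let z := (v 2 - v 3) / 2
  let y := (v 0 + v 1) / 2
  let x := (v 1 + v 3) / 2 + z
  refine ⟨![x, v 0 + x - y - z, y, z], fun j => ?_⟩
  fin_cases j <;> simp [weight, triIdx, Fin.sum_univ_four, x, y, z] <;> ring

/-- Equality of hypermatrices can be checked on the sixteen entries. -/
lemma ext_fin_two {S T : V} (h : (∀ a b c d, S a b c d = T a b c d)) : S = T := by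
  ext a b c d; exact h a b c d

lemma wForm_eq_sparse (c : Fin 4 → ℝ) : wForm c = sparse wIdx c := by
  refine ext_fin_two ?_
  simp [wForm, sparse, ofCoord, wIdx, Fin.sum_univ_four, Fin.forall_fin_succ]

lemma rep_pair_eq {δ α : SignType} (hδ : δ ≠ 0) (hα : α ≠ 0) :
    rep .pair ![δ, α, 0, 0] = sparse pairIdx ![(δ : ℝ), (α : ℝ), 1, 0] := by
  refine ext_fin_two ?_
  simp [rep, wForm, unitForm, sparse, ofCoord, pairIdx, Fin.sum_univ_four,
    Fin.forall_fin_succ, hδ, hα]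

lemma rep_cross_eq {p q r : SignType} (hp : p ≠ 0) (hq : q ≠ 0) (hr : r ≠ 0) :
    rep .cross ![0, p, q, r] = sparse crossIdx ![1, (p : ℝ), (q : ℝ), (r : ℝ)] := by
  refine ext_fin_two ?_
  simp [rep, cForm, unitForm, sparse, ofCoord, crossIdx, Fin.sum_univ_four,
    Fin.forall_fin_succ, hp, hq, hr]

lemma rep_re_eq {p q r : SignType} (hp : p ≠ 0) (hq : q ≠ 0) (hr : r ≠ 0) :
    rep .re ![0, p, q, r] = sparse reIdx ![1, (p : ℝ), (q : ℝ), (r : ℝ)] := by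
  refine ext_fin_two ?_
  simp [rep, cForm, unitForm, sparse, ofCoord, reIdx, Fin.sum_univ_four,
    Fin.forall_fin_succ, hp, hq, hr]

lemma rep_ghz_eq : rep .ghz ![1, 0, 0, 0] = sparse ghzIdx ![1, 1, 0, 0] := by
  refine ext_fin_two ?_
  simp [rep, unitForm, sparse, ofCoord, ghzIdx, Fin.sum_univ_four,
    Fin.forall_fin_succ]

lemma rep_tri_eq {p q r : SignType} (hp : p ≠ 0) (hq : q ≠ 0) (hr : r ≠ 0) :
    rep .tri ![p, q, r, 0] = sparse triIdx ![1, (p : ℝ), (q : ℝ), (r : ℝ)] := by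
  have : toLast ![p, q, r, 0] = 1 := by simp [toLast, zeroPos, hp, hq, hr]; rfl
  refine ext_fin_two ?_
  simp [rep, this, mForm, signVec, sparse, ofCoord, triIdx, Fin.sum_univ_four,
    Fin.forall_fin_succ]

/-! ### Reduction to normal forms -/

/-- A hypermatrix equivalent to one of the representatives. -/
def Good (T : V) : Prop := ∃ κ s, Valid κ s ∧ Equ T (rep κ s)

lemma Equ.good {S T : V} (h : Equ S T) : Good T → Good S :=
  fun ⟨κ, s, hs, hT⟩ => ⟨κ, s, hs, h.trans hT⟩

lemma sign_signType (s : SignType) : SignType.sign (s : ℝ) = s := by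
  cases s <;> simp

lemma signType_cast_eq_zero {s : SignType} : (s : ℝ) = 0 ↔ s = 0 := by
  cases s <;> simp

lemma perm_swap_zero_two (T : V) : perm (Equiv.swap 0 2) T = fun a b c d => T c b a d := rfl

lemma perm_swap_one_two (T : V) : perm (Equiv.swap 1 2) T = fun a b c d => T a c b d := rfl

lemma equ_sparse_mul {n : Fin 4 → Fin 4 → Fin 2} (hn : IndepWeights n) {v w : Fin 4 → ℝ} {t : ℝ}
    (ht : t ≠ 0) (h : ∀ j, SignType.sign (v j * t) = SignType.sign (w j)) :
    Equ (sparse n v) (sparse n w) := by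
  rcases ht.lt_or_gt with ht | ht
  · refine (equ_neg _).trans ?_
    rw [neg_sparse]
    refine equ_sparse hn fun j => ?_
    rw [← h j, sign_mul, sign_neg ht, Pi.neg_apply, Left.sign_neg, mul_neg_one]
  · refine equ_sparse hn fun j => ?_
    rw [← h j, sign_mul, sign_pos ht, mul_one]

lemma good_wForm {c : Fin 4 → ℝ} (hc : c ≠ 0) : Good (wForm c) := by
  refine ⟨.w, fun k => SignType.sign (c k), ?_, ?_⟩
  · obtain ⟨k, hk⟩ := Function.ne_iff.1 hc
    exact Finset.card_ne_zero_of_mem (Finset.mem_filter.2 ⟨Finset.mem_univ k, by simpa using hk⟩)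
  · rw [rep, wForm_eq_sparse, wForm_eq_sparse]
    exact equ_sparse indep_wIdx fun j => by rw [sign_signType]

lemma good_pair {a b c : ℝ} (ha : a ≠ 0) (hb : b ≠ 0) (hc : c ≠ 0) :
    Good (sparse pairIdx ![a, b, c, 0]) := by
  have h1 : SignType.sign (a * c) ≠ 0 := by simp [ha, hc]
  have h2 : SignType.sign (b * c) ≠ 0 := by simp [hb, hc]
  refine ⟨.pair, ![SignType.sign (a * c), SignType.sign (b * c), 0, 0], ?_, ?_⟩
  · generalize SignType.sign (a * c) = p at *
    generalize SignType.sign (b * c) = q at *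
    revert p q; decide
  · rw [rep_pair_eq h1 h2]
    refine equ_sparse_mul indep_pairIdx hc fun j => ?_
    fin_cases j <;> simp [sign_signType, hc]

lemma good_cross {a b c d : ℝ} (ha : a ≠ 0) (hb : b ≠ 0) (hc : c ≠ 0) (hd : d ≠ 0) :
    Good (sparse crossIdx ![a, b, c, d]) := by
  have h1 : SignType.sign (b * a) ≠ 0 := by simp [ha, hb]
  have h2 : SignType.sign (c * a) ≠ 0 := by simp [ha, hc]
  have h3 : SignType.sign (d * a) ≠ 0 := by simp [ha, hd]
  refine ⟨.cross, ![0, SignType.sign (b * a), SignType.sign (c * a), SignType.sign (d * a)], ?_, ?_⟩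
  · generalize SignType.sign (b * a) = p at *
    generalize SignType.sign (c * a) = q at *
    generalize SignType.sign (d * a) = r at *
    revert p q r; decide
  · rw [rep_cross_eq h1 h2 h3]
    refine equ_sparse_mul indep_crossIdx ha fun j => ?_
    fin_cases j <;> simp [sign_signType, ha]

lemma good_re {a b c d : ℝ} (h : a * b * c * d < 0) : Good (sparse reIdx ![a, b, c, d]) := by
  have ha : a ≠ 0 := by rintro rfl; simp at h
  have hs : SignType.sign (b * a) * SignType.sign (c * a) * SignType.sign (d * a) = -1 := by
    rw [← sign_mul, ← sign_mul, sign_eq_neg_one_iff]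
    nlinarith [sq_pos_of_ne_zero ha]
  have h1 : SignType.sign (b * a) ≠ 0 := by intro h0; simp [h0] at hs
  have h2 : SignType.sign (c * a) ≠ 0 := by intro h0; simp [h0] at hs
  have h3 : SignType.sign (d * a) ≠ 0 := by intro h0; simp [h0] at hs
  refine ⟨.re, ![0, SignType.sign (b * a), SignType.sign (c * a), SignType.sign (d * a)], ?_, ?_⟩
  · generalize SignType.sign (b * a) = p at *
    generalize SignType.sign (c * a) = q at *
    generalize SignType.sign (d * a) = r at *
    revert p q r; decide
  · rw [rep_re_eq h1 h2 h3]
    refine equ_sparse_mul indep_reIdx ha fun j => ?_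
    fin_cases j <;> simp [sign_signType, ha]

lemma equ_ghz_swap (a b : ℝ) :
    Equ (sparse ghzIdx ![a, b, 0, 0]) (sparse ghzIdx ![b, -a, 0, 0]) := by
  refine (equ_snd _ (p := 0) (q := 1) (r := -1) (s := 0) (by norm_num)).trans <|
    (equ_trd _ (p := 0) (q := 1) (r := -1) (s := 0) (by norm_num)).trans <|
    (equ_fth _ (p := 0) (q := 1) (r := -1) (s := 0) (by norm_num)).trans (.of_eq ?_)
  refine ext_fin_two ?_
  simp [sparse, ofCoord, ghzIdx, Fin.sum_univ_four, Fin.forall_fin_succ]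

lemma good_ghz {a b : ℝ} (ha : a ≠ 0) (hb : b ≠ 0) : Good (sparse ghzIdx ![a, b, 0, 0]) := by
  have key : ∀ {a b : ℝ}, 0 < a * b → Good (sparse ghzIdx ![a, b, 0, 0]) := fun {a b} h => by
    have ha : a ≠ 0 := by rintro rfl; simp at h
    refine ⟨.ghz, ![1, 0, 0, 0], by decide, ?_⟩
    rw [rep_ghz_eq]
    refine equ_sparse_mul indep_ghzIdx ha fun j => ?_
    fin_cases j <;> simp [ha]
    exact sign_pos (by linarith)
  rcases (mul_ne_zero ha hb).lt_or_gt with h | h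
  · exact (equ_ghz_swap a b).good (key (by linarith))
  · exact key h

/-- The determinant of a pair of vectors in the plane. -/
def br (u v : Fin 2 → ℝ) : ℝ := u 0 * v 1 - u 1 * v 0

lemma equ_mForm_three {u : Fin 4 → Fin 2 → ℝ} (h : br (u 0) (u 1) ≠ 0) :
    Equ (mForm 3 u) (sparse triIdx
      ![1, br (u 0) (u 1), br (u 2) (u 1) / br (u 0) (u 1), br (u 0) (u 2)]) := by
  refine (equ_fth _ (p := u 1 1 / br (u 0) (u 1)) (q := -u 1 0 / br (u 0) (u 1)) (r := -u 0 1)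
    (s := u 0 0) ?_).trans (.of_eq (ext_fin_two ?_))
  · field_simp; simp only [br]; ring
  · simp [mForm, sparse, ofCoord, triIdx, Fin.sum_univ_four, Fin.forall_fin_succ]
    refine ⟨⟨⟨?_, ?_⟩, ?_, ?_⟩, ?_, ?_⟩ <;> (try field_simp) <;> (try simp only [br]) <;> ring

/-- The vectors in the first three places are pairwise independent. -/
def Generic (u : Fin 4 → Fin 2 → ℝ) : Prop := ∀ ⦃i j⦄, i ≠ j → i ≠ 3 → j ≠ 3 → br (u i) (u j) ≠ 0

lemma Generic.comp {u : Fin 4 → Fin 2 → ℝ} (hu : Generic u) {e : Equiv.Perm (Fin 4)}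
    (he : e 3 = 3) : Generic (u ∘ e) := fun _ _ hij hi hj =>
  hu (e.injective.ne hij) (fun h => hi (e.injective (h.trans he.symm)))
    fun h => hj (e.injective (h.trans he.symm))

lemma Generic.equ {u : Fin 4 → Fin 2 → ℝ} (hu : Generic u) :
    ∃ p q r : SignType, p ≠ 0 ∧ q ≠ 0 ∧ r ≠ 0 ∧ Equ (mForm 3 u) (rep .tri ![p, q, r, 0]) := by
  have h01 := hu (i := 0) (j := 1) (by decide) (by decide) (by decide)
  have h21 := hu (i := 2) (j := 1) (by decide) (by decide) (by decide)
  have h02 := hu (i := 0) (j := 2) (by decide) (by decide) (by decide)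
  have hp := sign_ne_zero.2 h01
  have hq := sign_ne_zero.2 (div_ne_zero h21 h01)
  have hr := sign_ne_zero.2 h02
  refine ⟨_, _, _, hp, hq, hr, (equ_mForm_three h01).trans ?_⟩
  rw [rep_tri_eq hp hq hr]
  refine equ_sparse indep_triIdx fun j => ?_
  fin_cases j <;> simp [sign_signType]

lemma generic_signVec {s : Fin 4 → SignType} (h0 : s 0 ≠ 0) (h1 : s 1 ≠ 0) (h2 : s 2 ≠ 0) :
    Generic (signVec s) := by
  intro i j hij hi hj
  fin_cases i <;> fin_cases j <;> simp_all [signVec, br, signType_cast_eq_zero]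

lemma toLast_comp_swap : ∀ (p q r : SignType) (f : Fin 4), p ≠ 0 → q ≠ 0 → r ≠ 0 →
    toLast (![p, q, r, 0] ∘ Equiv.swap f 3) = Equiv.swap f 3 := by decide +kernel

lemma perm_rep_tri {p q r : SignType} (hp : p ≠ 0) (hq : q ≠ 0) (hr : r ≠ 0) (f : Fin 4) :
    perm (Equiv.swap f 3) (rep .tri ![p, q, r, 0]) =
      rep .tri (![p, q, r, 0] ∘ Equiv.swap f 3) := by
  have h1 : toLast ![p, q, r, 0] = 1 := by
    have := toLast_comp_swap p q r 3 hp hq hr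
    rwa [Equiv.swap_self] at this
  have h2 := toLast_comp_swap p q r f hp hq hr
  have h3 : (![p, q, r, 0] ∘ Equiv.swap f 3) ∘ Equiv.swap f 3 = ![p, q, r, 0] := by
    ext k; simp
  rw [rep, rep, h1, h2, h3, perm_one]
  rfl

lemma Generic.good_perm {u : Fin 4 → Fin 2 → ℝ} (hu : Generic u) (e : Equiv.Perm (Fin 4)) :
    Good (perm e (mForm 3 u)) := by
  let σ := Equiv.swap (e 3) 3
  have hσ : (e⁻¹ * σ) 3 = 3 := by simp [σ]
  have h1 : perm e (mForm 3 u) = perm σ (mForm 3 (u ∘ (e⁻¹ * σ : Equiv.Perm (Fin 4)))) := by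
    rw [perm_mForm, perm_mForm]
    congr 1
    · simp [σ]
    · ext k; simp [σ]
  obtain ⟨p, q, r, hp, hq, hr, h⟩ := (hu.comp hσ).equ
  rw [h1]
  refine ⟨.tri, _, ?_, (perm_rep_tri hp hq hr (e 3)) ▸ h.perm σ⟩
  have key : ∀ p q r : SignType, p ≠ 0 → q ≠ 0 → r ≠ 0 → Valid .tri ![p, q, r, 0] := by decide
  exact (key p q r hp hq hr).comp _

lemma Good.perm {T : V} (hT : Good T) (e : Equiv.Perm (Fin 4)) : Good (perm e T) := by
  obtain ⟨κ, s, hs, hT⟩ := hT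
  refine (hT.perm e).good ?_
  by_cases hκ : κ = .tri
  · subst hκ
    have key : ∀ s, Valid .tri s → s (toLast s 0) ≠ 0 ∧ s (toLast s 1) ≠ 0 ∧
        s (toLast s 2) ≠ 0 := by
      decide +kernel
    obtain ⟨h0, h1, h2⟩ := key s hs
    rw [rep, perm_perm]
    exact (generic_signVec (s := s ∘ toLast s) h0 h1 h2).good_perm _
  · exact ⟨κ, _, hs.comp e.symm, perm_rep hκ e s ▸ .refl _⟩

lemma good_of_perm {T : V} (e : Equiv.Perm (Fin 4)) (hT : Good (Hypermatrix.perm e T)) :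
    Good T := by
  have := hT.perm e⁻¹
  rwa [perm_perm, inv_mul_cancel, perm_one] at this

lemma good_mForm_of_br_eq_zero {u : Fin 4 → Fin 2 → ℝ} (h : br (u 0) (u 1) ≠ 0)
    (h2 : br (u 0) (u 2) = 0) : Good (mForm 3 u) := by
  refine (equ_mForm_three h).good ?_
  rw [h2]
  generalize br (u 0) (u 1) = x at *
  generalize br (u 2) (u 1) / x = y
  by_cases hy : y = 0
  · refine (equ_fst _ (p := 0) (q := 1) (r := -1) (s := 0) (by norm_num)).good
      (good_of_perm (Equiv.swap 0 2) ?_)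
    convert good_ghz one_ne_zero (neg_ne_zero.2 h) using 1
    refine ext_fin_two ?_
    simp [perm_swap_zero_two, sparse, ofCoord, triIdx, ghzIdx, Fin.sum_univ_four,
      Fin.forall_fin_succ, hy]
  · refine good_of_perm (Equiv.swap 1 2) ?_
    convert good_pair one_ne_zero hy h using 1
    refine ext_fin_two ?_
    simp [perm_swap_one_two, sparse, ofCoord, triIdx, pairIdx, Fin.sum_univ_four,
      Fin.forall_fin_succ]

lemma good_mForm_of_br {u : Fin 4 → Fin 2 → ℝ} (h : br (u 0) (u 1) ≠ 0) : Good (mForm 3 u) := by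
  have anti : ∀ v w, br v w = -br w v := fun v w => by simp only [br]; ring
  by_cases h2 : br (u 0) (u 2) = 0
  · exact good_mForm_of_br_eq_zero h h2
  by_cases h3 : br (u 1) (u 2) = 0
  · refine good_of_perm (Equiv.swap 0 1) ?_
    rw [perm_mForm, Equiv.swap_apply_of_ne_of_ne (by decide) (by decide)]
    refine good_mForm_of_br_eq_zero ?_ ?_
    · simpa [anti (u 1)] using h
    · exact h3
  · have h' : br (u 1) (u 0) ≠ 0 := by rw [anti]; exact neg_ne_zero.2 h
    have h2' : br (u 2) (u 0) ≠ 0 := by rw [anti]; exact neg_ne_zero.2 h2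
    have h3' : br (u 2) (u 1) ≠ 0 := by rw [anti]; exact neg_ne_zero.2 h3
    have : Generic u := fun i j hij hi hj => by
      fin_cases i <;> fin_cases j <;> first | assumption | exact absurd rfl ‹_›
    simpa using this.good_perm 1

lemma good_mForm {u : Fin 4 → Fin 2 → ℝ} {i j : Fin 4} (hi : i ≠ 3) (hj : j ≠ 3)
    (h : br (u i) (u j) ≠ 0) : Good (mForm 3 u) := by
  have hij : i ≠ j := by rintro rfl; exact h (by simp only [br]; ring)
  obtain ⟨e, h0, h1, h3⟩ : ∃ e : Equiv.Perm (Fin 4), e.symm 0 = i ∧ e.symm 1 = j ∧ e 3 = 3 := by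
    clear h; revert i j; decide +kernel
  refine good_of_perm e ?_
  rw [perm_mForm, h3]
  apply good_mForm_of_br
  simpa [h0, h1]

/-- A unimodular matrix whose second row annihilates the columns of a singular matrix. -/
lemma exists_unimodular {a b c d : ℝ} (h : a * d - b * c = 0) :
    ∃ p q r s : ℝ, p * s - q * r = 1 ∧ r * a + s * c = 0 ∧ r * b + s * d = 0 := by
  have key : ∀ r s : ℝ, r ^ 2 + s ^ 2 ≠ 0 → r * a + s * c = 0 → r * b + s * d = 0 →
      ∃ p q r s : ℝ, p * s - q * r = 1 ∧ r * a + s * c = 0 ∧ r * b + s * d = 0 :=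
    fun r s h0 h1 h2 => ⟨s / (r ^ 2 + s ^ 2), -r / (r ^ 2 + s ^ 2), r, s, by field_simp; ring,
      h1, h2⟩
  by_cases hac : c ^ 2 + a ^ 2 = 0
  · have ha : a = 0 := by nlinarith [sq_nonneg a, sq_nonneg c]
    have hc : c = 0 := by nlinarith [sq_nonneg a, sq_nonneg c]
    subst ha hc
    by_cases hbd : d ^ 2 + b ^ 2 = 0
    · have hb : b = 0 := by nlinarith [sq_nonneg b, sq_nonneg d]
      have hd : d = 0 := by nlinarith [sq_nonneg b, sq_nonneg d]
      exact key 1 0 (by simp) (by simp) (by simp [hb])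
    · exact key d (-b) (by simpa using hbd) (by simp) (by ring)
  · exact key c (-a) (by simpa using hac) (by ring) (by linarith)

lemma actG_zero (g : G) : actG g 0 = 0 := by
  ext; simp [actG]

lemma Equ.ne_zero {S T : V} (h : Equ S T) (hS : S ≠ 0) : T ≠ 0 := by
  rintro rfl
  obtain ⟨g, hg⟩ := h.symm
  exact hS (hg.symm.trans (actG_zero g))

lemma Equ.good_of_ne_zero {S T : V} (h : Equ S T) (hS : S ≠ 0) (hT : T ≠ 0 → Good T) : Good S :=
  h.good (hT (h.ne_zero hS))

lemma good_of_eq_wForm {T : V} {c : Fin 4 → ℝ} (hT : T ≠ 0) (h : T = wForm c) : Good T := by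
  subst h
  refine good_wForm ?_
  rintro rfl
  exact hT (ext_fin_two (by simp [wForm, ofCoord]))

/-- A vector in the plane is a multiple of a fixed one up to a unimodular change of basis. -/
lemma exists_unimodular_fst (a c : ℝ) :
    ∃ p q r s : ℝ, p * s - q * r = 1 ∧ p * a + q * c = 0 := by
  obtain ⟨p, q, r, s, h, h1, -⟩ := exists_unimodular (a := a) (b := 0) (c := c) (d := 0) (by ring)
  exact ⟨r, s, -p, -q, by linarith, h1⟩

/-- Good hypermatrices with a single nonzero matrix slice. -/
lemma good_of_matrix {T : V} (h1 : ∀ b c d, T 1 b c d = 0) (h2 : ∀ c d, T 0 1 c d = 0)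
    (hT : T ≠ 0) : Good T := by
  suffices key : ∀ T : V, (∀ b c d, T 1 b c d = 0) → (∀ c d, T 0 1 c d = 0) → T 0 0 0 0 = 0 →
      T ≠ 0 → Good T by
    obtain ⟨p, q, r, s, h, h3⟩ := exists_unimodular_fst (T 0 0 0 0) (T 0 0 1 0)
    exact (equ_trd T h).good_of_ne_zero hT (key _ (by simp [h1]) (by simp [h2]) (by simp [h3]))
  intro T h1 h2 h3 hT
  by_cases h11 : T 0 0 1 1 = 0
  · refine good_of_eq_wForm (c := ![0, 0, T 0 0 1 0, T 0 0 0 1]) hT (ext_fin_two ?_)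
    simp [wForm, ofCoord, Fin.sum_univ_four, Fin.forall_fin_succ, h1, h2, h3, h11]
  by_cases h01 : T 0 0 0 1 = 0
  · by_cases h10 : T 0 0 1 0 = 0
    · refine (equ_trd T (p := 0) (q := 1) (r := -1) (s := 0) (by norm_num)).good_of_ne_zero hT
        fun hT' => good_of_eq_wForm (c := ![0, 0, 0, T 0 0 1 1]) hT' (ext_fin_two ?_)
      simp [wForm, ofCoord, Fin.sum_univ_four, Fin.forall_fin_succ, h1, h2, h3, h01, h10]
    · refine (equ_fth T (p := 1) (q := 0) (r := -T 0 0 1 1 / T 0 0 1 0) (s := 1)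
        (by norm_num)).good_of_ne_zero hT fun hT' =>
        good_of_eq_wForm (c := ![0, 0, T 0 0 1 0, 0]) hT' (ext_fin_two ?_)
      simp [wForm, ofCoord, Fin.sum_univ_four, Fin.forall_fin_succ, h1, h2, h3, h01, h10]
  · refine (equ_trd T (p := 1) (q := 0) (r := -T 0 0 1 1 / T 0 0 0 1) (s := 1)
      (by norm_num)).good_of_ne_zero hT fun hT' =>
      good_of_eq_wForm (c := ![0, 0, T 0 0 1 0, T 0 0 0 1]) hT' (ext_fin_two ?_)
    simp [wForm, ofCoord, Fin.sum_univ_four, Fin.forall_fin_succ, h1, h2, h3, h01]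

lemma good_of_singular_slice {T : V} (h1 : ∀ b c d, T 1 b c d = 0) (h01 : T 0 1 0 1 = 0)
    (h10 : T 0 1 1 0 = 0) (h11 : T 0 1 1 1 = 0) (hT : T ≠ 0) : Good T := by
  by_cases h00 : T 0 1 0 0 = 0
  · exact good_of_matrix h1 (by simp [Fin.forall_fin_succ, *]) hT
  by_cases h : T 0 0 1 1 = 0
  · refine (equ_snd T (p := 1) (q := -T 0 0 0 0 / T 0 1 0 0) (r := 0) (s := 1)
      (by norm_num)).good_of_ne_zero hT fun hT' =>
      good_of_eq_wForm (c := ![0, T 0 1 0 0, T 0 0 1 0, T 0 0 0 1]) hT' (ext_fin_two ?_)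
    simp [wForm, ofCoord, Fin.sum_univ_four, Fin.forall_fin_succ, h1, h00, h01, h10, h11, h]
  · refine (equ_trd T (p := 1) (q := -T 0 0 0 1 / T 0 0 1 1) (r := 0) (s := 1)
      (by norm_num)).good ((equ_fth _ (p := 1) (q := -T 0 0 1 0 / T 0 0 1 1) (r := 0) (s := 1)
      (by norm_num)).good ?_)
    set x := T 0 0 0 0 + -T 0 0 0 1 / T 0 0 1 1 * T 0 0 1 0 with hx
    refine (equ_snd _ (p := 0) (q := 1) (r := -1) (s := x / T 0 1 0 0) (by norm_num)).good ?_
    convert good_ghz h00 (neg_ne_zero.2 h) using 1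
    refine ext_fin_two ?_
    simp [sparse, ofCoord, ghzIdx, Fin.sum_univ_four, Fin.forall_fin_succ, h1, h00, h01, h10, h11,
      h]
    rw [hx]; field_simp; ring

lemma good_of_definite_pencil {T : V} (h1 : ∀ b c d, T 1 b c d = 0) (h00 : T 0 0 0 0 = 1)
    (h01 : T 0 0 0 1 = 0) (h10 : T 0 0 1 0 = 0)
    (hd : T 0 1 1 1 = - T 0 0 1 1 * T 0 1 0 0)
    (h : (T 0 0 1 1 * T 0 1 0 0) ^ 2 + T 0 0 1 1 * T 0 1 0 1 * T 0 1 1 0 < 0) : Good T := by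
  have hg : T 0 1 1 0 ≠ 0 := fun h0 => by
    rw [h0] at h; nlinarith [sq_nonneg (T 0 0 1 1 * T 0 1 0 0)]
  refine (equ_trd T (p := 1) (q := -T 0 1 0 0 / T 0 1 1 0) (r := 0) (s := 1)
      (by norm_num)).good ((equ_fth _ (p := 1) (q := 0)
      (r := T 0 1 0 0 / T 0 1 1 0 * T 0 0 1 1) (s := 1) (by norm_num)).good ?_)
  have hlt : 1 * T 0 0 1 1 * (T 0 1 0 1 + T 0 0 1 1 * T 0 1 0 0 ^ 2 / T 0 1 1 0) *
      T 0 1 1 0 < 0 := by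
    convert h using 1
    field_simp
    ring
  convert good_re hlt using 1
  refine ext_fin_two ?_
  simp [sparse, ofCoord, reIdx, Fin.sum_univ_four, Fin.forall_fin_succ, h1, h00, h01, h10, hd]
  constructorm* _ ∧ _ <;> field_simp <;> ring

lemma good_of_pencil {T : V} (h1 : ∀ b c d, T 1 b c d = 0) (h00 : T 0 0 0 0 = 1)
    (h01 : T 0 0 0 1 = 0) (h10 : T 0 0 1 0 = 0) (h11 : T 0 0 1 1 ≠ 0)
    (h : (T 0 1 1 1 + T 0 0 1 1 * T 0 1 0 0) ^ 2 -
      4 * T 0 0 1 1 * (T 0 1 0 0 * T 0 1 1 1 - T 0 1 0 1 * T 0 1 1 0) < 0) : Good T := by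
  refine (equ_snd _ (p := 1) (q := 0) (r := -(T 0 1 1 1 + T 0 0 1 1 * T 0 1 0 0) / (2 * T 0 0 1 1))
    (s := 1) (by norm_num)).good ?_
  apply good_of_definite_pencil
  · simp [h1]
  · simp [h00]
  · simp [h01]
  · simp [h10]
  · simp [h00]; field_simp; ring
  · simp [h00, h01, h10]
    field_simp
    linarith

/-- Hypermatrices supported on one slice are good. -/
lemma good_of_slice {T : V} (h1 : ∀ b c d, T 1 b c d = 0) (hT : T ≠ 0) : Good T := by
  have hroot : ∀ {T : V}, (∀ b c d, T 1 b c d = 0) → 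
      T 0 1 0 0 * T 0 1 1 1 - T 0 1 0 1 * T 0 1 1 0 = 0 → T ≠ 0 → Good T := by
    intro T h1 hdet hT
    obtain ⟨p, q, r, s, h, h3, h4⟩ := exists_unimodular hdet
    refine (equ_trd T h).good_of_ne_zero hT fun hT => ?_
    obtain ⟨p', q', r', s', h', h5⟩ :=
      exists_unimodular_fst (p * T 0 1 0 0 + q * T 0 1 1 0) (p * T 0 1 0 1 + q * T 0 1 1 1)
    refine (equ_fth _ (p := -r') (q := -s') (r := p') (s := q') (by linarith)).good_of_ne_zero hT
      fun hT => good_of_singular_slice ?_ ?_ ?_ ?_ hT <;> simp [h1, h3, h4, h5]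
  set P := T 0 0 0 0 * T 0 0 1 1 - T 0 0 0 1 * T 0 0 1 0 with hP
  set R := T 0 1 0 0 * T 0 1 1 1 - T 0 1 0 1 * T 0 1 1 0 with hR
  set K := T 0 0 0 0 * T 0 1 1 1 + T 0 1 0 0 * T 0 0 1 1 - T 0 0 0 1 * T 0 1 1 0 -
    T 0 1 0 1 * T 0 0 1 0 with hK
  by_cases hP0 : P = 0
  · refine (equ_snd T (p := 0) (q := 1) (r := -1) (s := 0) (by norm_num)).good_of_ne_zero hT
      fun hT => hroot (by simp [h1]) ?_ hT
    simp
    linarith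
  by_cases hd : 0 ≤ K ^ 2 - 4 * P * R
  · have hsq := Real.sq_sqrt hd
    refine (equ_snd T (p := 1) (q := 0) (r := (-K + √(K ^ 2 - 4 * P * R)) / (2 * P)) (s := 1)
      (by norm_num)).good_of_ne_zero hT fun hT => hroot (by simp [h1]) ?_ hT
    set w := √(K ^ 2 - 4 * P * R)
    simp
    have : P * ((-K + w) / (2 * P)) ^ 2 + K * ((-K + w) / (2 * P)) + R = 0 := by
      field_simp
      linear_combination hsq
    rw [← this, hP, hK, hR]
    ring
  push Not at hd
  refine (equ_trd T (p := T 0 0 1 1 / P) (q := -T 0 0 0 1 / P) (r := -T 0 0 1 0) (s := T 0 0 0 0)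
    (by field_simp; rw [hP]; ring)).good ?_
  set α := T 0 0 1 1 / P * T 0 1 0 0 - T 0 0 0 1 / P * T 0 1 1 0 with hα
  set β := T 0 0 1 1 / P * T 0 1 0 1 - T 0 0 0 1 / P * T 0 1 1 1 with hβ
  set γ := -T 0 0 1 0 * T 0 1 0 0 + T 0 0 0 0 * T 0 1 1 0 with hγ
  set κ := -T 0 0 1 0 * T 0 1 0 1 + T 0 0 0 0 * T 0 1 1 1 with hκ
  have hK' : K = κ + P * α := by rw [hK, hκ, hα]; field_simp; ring
  have hR' : R = α * κ - β * γ := by rw [hR, hκ, hα, hβ, hγ]; field_simp; rw [hP]; ring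
  have e11 : -T 0 0 1 0 * T 0 0 0 1 + T 0 0 0 0 * T 0 0 1 1 = P := by rw [hP]; ring
  apply good_of_pencil
  · simp [h1]
  · simp; field_simp; linarith
  · simp; field_simp; ring
  · simp; ring
  · simp only [Matrix.cons_val_zero, Matrix.cons_val_one]
    rwa [e11]
  · simp only [Matrix.cons_val_zero, Matrix.cons_val_one]
    refine lt_of_eq_of_lt ?_ hd
    rw [hK', hR', hα, hβ, hγ, hκ, e11]
    ring

lemma exists_combination {v w : Fin 2 → ℝ} (h : br v w ≠ 0) (z : Fin 2 → ℝ) :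
    ∃ x y : ℝ, ∀ d, z d = x * v d + y * w d := by
  refine ⟨br z w / br v w, br v z / br v w, fun d => ?_⟩
  field_simp
  fin_cases d <;> simp only [br] <;> simp <;> ring

/-- Hypermatrices supported on the multi-indices with at most one `1` in the first three places
are good. -/
lemma good_of_mForm {T : V} (h1 : ∀ c d, T 1 1 c d = 0) (h2 : ∀ b d, T 1 b 1 d = 0)
    (h3 : ∀ a d, T a 1 1 d = 0) (hT : T ≠ 0) : Good T := by
  set u : Fin 4 → Fin 2 → ℝ := ![T 1 0 0, T 0 1 0, T 0 0 1, 0] with hu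
  by_cases hbr : ∃ i j, i ≠ 3 ∧ j ≠ 3 ∧ br (u i) (u j) ≠ 0
  · obtain ⟨i, j, hi, hj, hij⟩ := hbr
    obtain ⟨x, y, hxy⟩ := exists_combination hij (T 0 0 0)
    let v : Fin 4 → ℝ := fun k => (if k = i then x else 0) + if k = j then y else 0
    have hv : ∀ d, T 0 0 0 d = v 0 * T 1 0 0 d + v 1 * T 0 1 0 d + v 2 * T 0 0 1 d := fun d => by
      rw [hxy, hu]
      fin_cases i <;> fin_cases j <;> simp_all [v] <;> ring
    refine (equ_fst T (p := 1) (q := -v 0) (r := 0) (s := 1) (by norm_num)).good ?_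
    refine (equ_snd _ (p := 1) (q := -v 1) (r := 0) (s := 1) (by norm_num)).good ?_
    refine (equ_trd _ (p := 1) (q := -v 2) (r := 0) (s := 1) (by norm_num)).good ?_
    convert good_mForm hi hj hij using 1
    refine ext_fin_two ?_
    simp [mForm, ofCoord, Fin.sum_univ_four, Fin.forall_fin_succ, h1, h2, h3, hv, hu]
    constructor <;> ring
  push Not at hbr
  obtain ⟨p, q, r, s, h, hk⟩ : ∃ p q r s : ℝ, p * s - q * r = 1 ∧
      ∀ k, k ≠ 3 → r * u k 0 + s * u k 1 = 0 := by
    by_cases hz : ∀ k, k ≠ 3 → u k = 0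
    · exact ⟨1, 0, 0, 1, by norm_num, fun k hk => by simp [hz k hk]⟩
    · push Not at hz
      obtain ⟨i, hi, hui⟩ := hz
      have hn : u i 0 ^ 2 + u i 1 ^ 2 ≠ 0 := fun h0 => hui <| by
        ext d
        fin_cases d <;> simp <;> nlinarith [sq_nonneg (u i 0), sq_nonneg (u i 1)]
      refine ⟨-u i 0 / (u i 0 ^ 2 + u i 1 ^ 2), -u i 1 / (u i 0 ^ 2 + u i 1 ^ 2), u i 1, -u i 0,
        by field_simp; ring, fun k hk => ?_⟩
      have := hbr k i hk hi
      simp only [br] at this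
      linarith
  have hk0 := hk 0 (by decide)
  have hk1 := hk 1 (by decide)
  have hk2 := hk 2 (by decide)
  simp only [hu, Matrix.cons_val] at hk0 hk1 hk2
  suffices key : ∀ T : V, (∀ c d, T 1 1 c d = 0) → (∀ b d, T 1 b 1 d = 0) →
      (∀ a d, T a 1 1 d = 0) → T 1 0 0 1 = 0 → T 0 1 0 1 = 0 → T 0 0 1 1 = 0 → T ≠ 0 → Good T from
    (equ_fth T h).good_of_ne_zero hT (key _ (by simp [h1]) (by simp [h2]) (by simp [h3])
      (by simpa using hk0) (by simpa using hk1) (by simpa using hk2))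
  clear! T p q r s
  intro T h1 h2 h3 h4 h5 h6 hT
  by_cases hc0 : T 1 0 0 0 = 0
  · by_cases hc1 : T 0 1 0 0 = 0
    · by_cases hc2 : T 0 0 1 0 = 0
      · obtain ⟨p, q, r, s, h, hz⟩ := exists_unimodular_fst (T 0 0 0 0) (T 0 0 0 1)
        refine (equ_fth T h).good_of_ne_zero hT fun hT' =>
          good_of_eq_wForm (c := ![0, 0, 0, r * T 0 0 0 0 + s * T 0 0 0 1]) hT' (ext_fin_two ?_)
        simp [wForm, ofCoord, Fin.sum_univ_four, Fin.forall_fin_succ, *]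
      · refine (equ_trd T (p := 1) (q := -T 0 0 0 0 / T 0 0 1 0) (r := 0) (s := 1)
          (by norm_num)).good_of_ne_zero hT fun hT' =>
          good_of_eq_wForm (c := ![0, 0, T 0 0 1 0, T 0 0 0 1]) hT' (ext_fin_two ?_)
        simp [wForm, ofCoord, Fin.sum_univ_four, Fin.forall_fin_succ, *]
    · refine (equ_snd T (p := 1) (q := -T 0 0 0 0 / T 0 1 0 0) (r := 0) (s := 1)
        (by norm_num)).good_of_ne_zero hT fun hT' =>
        good_of_eq_wForm (c := ![0, T 0 1 0 0, T 0 0 1 0, T 0 0 0 1]) hT' (ext_fin_two ?_)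
      simp [wForm, ofCoord, Fin.sum_univ_four, Fin.forall_fin_succ, *]
  · refine (equ_fst T (p := 1) (q := -T 0 0 0 0 / T 1 0 0 0) (r := 0) (s := 1)
      (by norm_num)).good_of_ne_zero hT fun hT' =>
      good_of_eq_wForm (c := ![T 1 0 0 0, T 0 1 0 0, T 0 0 1 0, T 0 0 0 1]) hT' (ext_fin_two ?_)
    simp [wForm, ofCoord, Fin.sum_univ_four, Fin.forall_fin_succ, *]

lemma good_of_cross {T : V} (h1 : ∀ c d, T 1 1 c d = 0) (h2 : ∀ b d, T 1 b 1 d = 0)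
    (h3 : ∀ b c, T 1 b c 1 = 0) (h111 : T 0 1 1 1 = 0) (h001 : T 0 0 0 1 = 0) (h010 : T 0 0 1 0 = 0)
    (h100 : T 0 1 0 0 = 0) (ht : T 1 0 0 0 ≠ 0) (ha : T 0 0 1 1 ≠ 0) (hb : T 0 1 0 1 ≠ 0)
    (hc : T 0 1 1 0 ≠ 0) : Good T := by
  refine (equ_fst T (p := 1) (q := -T 0 0 0 0 / T 1 0 0 0) (r := 0) (s := 1) (by norm_num)).good ?_
  convert good_cross ht ha hb hc using 1
  refine ext_fin_two ?_
  simp [sparse, ofCoord, crossIdx, Fin.sum_univ_four, Fin.forall_fin_succ, *]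

/-- Hypermatrices supported on the multi-indices `1000` and `0***` other than `0111` are good. -/
lemma good_of_slice_of_single {T : V} (h1 : ∀ c d, T 1 1 c d = 0) (h2 : ∀ b d, T 1 b 1 d = 0)
    (h3 : ∀ b c, T 1 b c 1 = 0) (h111 : T 0 1 1 1 = 0) (hT : T ≠ 0) : Good T := by
  by_cases ht : T 1 0 0 0 = 0
  · exact good_of_slice (by simp [Fin.forall_fin_succ, *]) hT
  by_cases ha : T 0 0 1 1 = 0
  · refine good_of_perm (Equiv.swap 1 3) ?_
    have hp : perm (Equiv.swap 1 3) T = fun a b c d => T a d c b := rfl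
    refine good_of_mForm ?_ ?_ ?_ ?_
    · simp [*]
    · simp [*]
    · simp [Fin.forall_fin_succ, *]
    · exact fun h0 => ht (congrFun (congrFun (congrFun (congrFun h0 1) 0) 0) 0)
  by_cases hb : T 0 1 0 1 = 0
  · refine good_of_perm (Equiv.swap 2 3) ?_
    have hp : perm (Equiv.swap 2 3) T = fun a b c d => T a b d c := rfl
    refine good_of_mForm ?_ ?_ ?_ ?_
    · simp [*]
    · simp [*]
    · simp [Fin.forall_fin_succ, *]
    · exact fun h0 => ht (congrFun (congrFun (congrFun (congrFun h0 1) 0) 0) 0)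
  by_cases hc : T 0 1 1 0 = 0
  · exact good_of_mForm h1 h2 (by simp [Fin.forall_fin_succ, *]) hT
  refine (equ_snd T (p := 1) (q := (-T 0 0 0 1 * T 0 1 1 0 - T 0 0 1 0 * T 0 1 0 1 +
    T 0 1 0 0 * T 0 0 1 1) / (2 * T 0 1 0 1 * T 0 1 1 0)) (r := 0) (s := 1) (by norm_num)).good ?_
  refine (equ_trd _ (p := 1) (q := (-T 0 0 0 1 * T 0 1 1 0 + T 0 0 1 0 * T 0 1 0 1 -
    T 0 1 0 0 * T 0 0 1 1) / (2 * T 0 0 1 1 * T 0 1 1 0)) (r := 0) (s := 1) (by norm_num)).good ?_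
  refine (equ_fth _ (p := 1) (q := (T 0 0 0 1 * T 0 1 1 0 - T 0 0 1 0 * T 0 1 0 1 -
    T 0 1 0 0 * T 0 0 1 1) / (2 * T 0 0 1 1 * T 0 1 0 1)) (r := 0) (s := 1) (by norm_num)).good ?_
  apply good_of_cross <;> simp [Fin.forall_fin_succ, *]
  all_goals
    field_simp
    ring

/-! ### The Hilbert–Mumford criterion -/

/-- The rotation by an angle. -/
noncomputable def rot (φ : ℝ) : Matrix.SpecialLinearGroup (Fin 2) ℝ :=
  sl (Real.cos φ) (Real.sin φ) (-Real.sin φ) (Real.cos φ) (by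
    linarith [Real.cos_sq_add_sin_sq φ])

lemma exists_orthogonal (g : Matrix (Fin 2) (Fin 2) ℝ) : ∃ φ ∈ Set.Icc 0 (Real.pi / 2),
    ∑ i, (Real.cos φ * g i 0 + Real.sin φ * g i 1) *
      (-Real.sin φ * g i 0 + Real.cos φ * g i 1) = 0 := by
  set f : ℝ → ℝ := fun φ => ∑ i, (Real.cos φ * g i 0 + Real.sin φ * g i 1) *
      (-Real.sin φ * g i 0 + Real.cos φ * g i 1)
  have hf : Continuous f := by fun_prop
  have h0 : f (Real.pi / 2) = -f 0 := by simp [f]; ring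
  have hpi : (0 : ℝ) ≤ Real.pi / 2 := by positivity
  rcases le_total (f 0) 0 with h | h
  · exact intermediate_value_Icc hpi hf.continuousOn ⟨h, by rw [h0]; linarith⟩
  · exact intermediate_value_Icc' hpi hf.continuousOn ⟨by rw [h0]; linarith, h⟩

/-- A form of the singular value decomposition. -/
lemma exists_svd (g : Matrix.SpecialLinearGroup (Fin 2) ℝ) : ∃ φ ∈ Set.Icc 0 Real.pi, ∃ m : ℝ,
    0 ≤ m ∧ ∃ k : Matrix.SpecialLinearGroup (Fin 2) ℝ, (∀ i j, |k i j| ≤ 1) ∧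
      k * g = slExp (-m) * rot φ := by
  have hdet : g 0 0 * g 1 1 - g 0 1 * g 1 0 = 1 := by
    rw [← Matrix.det_fin_two]; exact g.2
  obtain ⟨φ, hφ, c, s, hc, hs, hcs, horth, hle⟩ : ∃ φ ∈ Set.Icc 0 Real.pi, ∃ c s : ℝ,
      Real.cos φ = c ∧ Real.sin φ = s ∧ c ^ 2 + s ^ 2 = 1 ∧
      ∑ i, (c * g i 0 + s * g i 1) * (-s * g i 0 + c * g i 1) = 0 ∧
      (c * g 0 0 + s * g 0 1) ^ 2 + (c * g 1 0 + s * g 1 1) ^ 2 ≤ 1 := by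
    obtain ⟨φ, hφ, h⟩ := exists_orthogonal g
    have hcs := Real.cos_sq_add_sin_sq φ
    by_cases hle : (Real.cos φ * g 0 0 + Real.sin φ * g 0 1) ^ 2 +
        (Real.cos φ * g 1 0 + Real.sin φ * g 1 1) ^ 2 ≤ 1
    · exact ⟨φ, ⟨hφ.1, by linarith [hφ.2, Real.pi_pos]⟩, _, _, rfl, rfl, hcs, h, hle⟩
    · refine ⟨φ + Real.pi / 2, ⟨by linarith [hφ.1, Real.pi_pos], by linarith [hφ.2]⟩, _, _,
        Real.cos_add_pi_div_two φ, Real.sin_add_pi_div_two φ, by linarith, ?_, ?_⟩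
      · rw [← neg_eq_zero, ← h, ← Finset.sum_neg_distrib]
        exact Finset.sum_congr rfl fun i _ => by ring
      · generalize Real.cos φ = c at *
        generalize Real.sin φ = s at *
        rw [Fin.sum_univ_two] at h
        by_contra hgt
        push Not at hle hgt
        have hprod : ((c * g 0 0 + s * g 0 1) ^ 2 + (c * g 1 0 + s * g 1 1) ^ 2) *
          ((-s * g 0 0 + c * g 0 1) ^ 2 + (-s * g 1 0 + c * g 1 1) ^ 2) = 1 := by
          have e1 : (c * g 0 0 + s * g 0 1) * (-s * g 1 0 + c * g 1 1) -
            (c * g 1 0 + s * g 1 1) * (-s * g 0 0 + c * g 0 1) = 1 := by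
            linear_combination (c ^ 2 + s ^ 2) * hdet + hcs
          generalize c * g 0 0 + s * g 0 1 = x at *
          generalize c * g 1 0 + s * g 1 1 = y at *
          generalize -s * g 0 0 + c * g 0 1 = z at *
          generalize -s * g 1 0 + c * g 1 1 = w at *
          linear_combination (x * z + y * w) * h + (x * w - y * z + 1) * e1
        nlinarith
  rw [Fin.sum_univ_two] at horth
  have e1 : (c * g 0 0 + s * g 0 1) * (-s * g 1 0 + c * g 1 1) -
      (c * g 1 0 + s * g 1 1) * (-s * g 0 0 + c * g 0 1) = 1 := by
    linear_combination (c ^ 2 + s ^ 2) * hdet + hcs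
  set x := c * g 0 0 + s * g 0 1 with hx
  set y := c * g 1 0 + s * g 1 1 with hy
  set z := -s * g 0 0 + c * g 0 1 with hz
  set w := -s * g 1 0 + c * g 1 1 with hw
  have hN : 0 < x ^ 2 + y ^ 2 := by
    by_contra h0
    have hx0 : x = 0 := by nlinarith [sq_nonneg x, sq_nonneg y]
    have hy0 : y = 0 := by nlinarith [sq_nonneg x, sq_nonneg y]
    rw [hx0, hy0] at e1
    norm_num at e1
  set N := √(x ^ 2 + y ^ 2) with hNdef
  have hNpos : 0 < N := Real.sqrt_pos.2 hN
  have hN2 : N ^ 2 = x ^ 2 + y ^ 2 := Real.sq_sqrt hN.le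
  have hN1 : N ≤ 1 := by nlinarith
  have hz' : z * N ^ 2 = -y := by rw [hN2]; linear_combination x * horth - y * e1
  have hw' : w * N ^ 2 = x := by rw [hN2]; linear_combination y * horth + x * e1
  have hxN : |x| ≤ N := Real.abs_le_sqrt (by nlinarith [sq_nonneg y])
  have hyN : |y| ≤ N := Real.abs_le_sqrt (by nlinarith [sq_nonneg x])
  have hk : x / N * (x / N) - y / N * (-y / N) = 1 := by field_simp; linarith
  refine ⟨φ, hφ, -Real.log N, by simpa using Real.log_nonpos hNpos.le hN1,
    sl (x / N) (y / N) (-y / N) (x / N) hk, ?_, ?_⟩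
  · intro i j
    fin_cases i <;> fin_cases j <;>
      simp [sl, abs_div, abs_of_pos hNpos, div_le_one hNpos, hxN, hyN]
  · have g00 : g 0 0 = c * x - s * z := by rw [hx, hz]; linear_combination (-g 0 0) * hcs
    have g10 : g 1 0 = c * y - s * w := by rw [hy, hw]; linear_combination (-g 1 0) * hcs
    have g01 : g 0 1 = s * x + c * z := by rw [hx, hz]; linear_combination (-g 0 1) * hcs
    have g11 : g 1 1 = s * y + c * w := by rw [hy, hw]; linear_combination (-g 1 1) * hcs
    clear_value x y z w N
    ext i j
    rw [Matrix.SpecialLinearGroup.coe_mul, Matrix.SpecialLinearGroup.coe_mul, Matrix.mul_apply,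
      Matrix.mul_apply, Fin.sum_univ_two, Fin.sum_univ_two]
    fin_cases i <;> fin_cases j <;>
      simp [sl, slExp, rot, Real.exp_neg, Real.exp_log hNpos,
        hc, hs, g00, g01, g10, g11] <;> field_simp
    · linear_combination -c * hN2 - s * horth
    · linear_combination -s * hN2 + c * horth
    · linear_combination -s * e1
    · linear_combination c * e1

lemma abs_coord_actG_le {k : Fin 4 → Matrix.SpecialLinearGroup (Fin 2) ℝ}
    (hk : ∀ f i j, |k f i j| ≤ 1) {T : V} {ε : ℝ} (hT : ∀ i, |coord T i| ≤ ε)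
    (i : Fin 4 → Fin 2) : |coord (actG (ofFactor k) T) i| ≤ 16 * ε := by
  rw [coord_actG]
  refine (Finset.abs_sum_le_sum_abs _ _).trans ?_
  have : ∀ j ∈ Finset.univ, |(∏ f, factor (ofFactor k) f (i f) (j f)) * coord T j| ≤ ε := by
    intro j _
    rw [abs_mul, Finset.abs_prod]
    have h1 : ∏ f, |factor (ofFactor k) f (i f) (j f)| ≤ 1 :=
      Finset.prod_le_one (fun _ _ => abs_nonneg _) fun f _ => by
        rw [factor_ofFactor]; exact hk f _ _
    exact (mul_le_of_le_one_left (abs_nonneg _) h1).trans (hT j)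
  refine (Finset.sum_le_card_nsmul _ _ _ this).trans_eq ?_
  simp

/-- The three sets of multi-indices that are forced to vanish on an unstable hypermatrix. -/
def Killed (t : Fin 3) (i : Fin 4 → Fin 2) : Prop :=
  ![i 0 = 1, i 0 = 1 ∧ ¬(i 1 = 0 ∧ i 2 = 0 ∧ i 3 = 0) ∨ i 0 = 0 ∧ i 1 = 1 ∧ i 2 = 1 ∧ i 3 = 1,
    i 0 = 1 ∧ i 1 = 1 ∨ i 0 = 1 ∧ i 2 = 1 ∨ i 1 = 1 ∧ i 2 = 1] t

lemma good_of_killed {T : V} (hT : T ≠ 0) (t : Fin 3) (h : ∀ i, Killed t i → coord T i = 0) :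
    Good T := by
  have h' : ∀ a b c d, Killed t ![a, b, c, d] → T a b c d = 0 := fun a b c d => h ![a, b, c, d]
  fin_cases t
  · exact good_of_slice (fun b c d => h' _ _ _ _ (by simp [Killed])) hT
  · refine good_of_slice_of_single ?_ ?_ ?_ ?_ hT
    all_goals intros; apply h'; simp [Killed]
  · refine good_of_mForm ?_ ?_ ?_ hT
    all_goals intros; apply h'; simp [Killed]

lemma exists_killed_weight {m : Fin 4 → ℝ} (hm : ∀ k, 0 ≤ m k) :
    ∃ (e : Equiv.Perm (Fin 4)) (t : Fin 3), ∀ i, Killed t i → 0 ≤ weight (-m) (i ∘ e) := by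
  have key : ∀ n : Fin 4 → ℝ, (∀ k, 0 ≤ n k) → n 1 ≤ n 0 → n 2 ≤ n 1 → n 3 ≤ n 2 →
      ∃ t : Fin 3, ∀ i, Killed t i → 0 ≤ weight (-n) i := by
    intro n h h01 h12 h23
    have two : ∀ x : Fin 2, x = 0 ∨ x = 1 := by decide
    have hn := h 3
    have finish : ∀ t : Fin 3, (∀ a b c d, Killed t ![a, b, c, d] →
        0 ≤ weight (-n) ![a, b, c, d]) → ∃ t : Fin 3, ∀ i, Killed t i → 0 ≤ weight (-n) i :=
      fun t ht => ⟨t, fun i => by rw [← vec_eq i]; exact ht _ _ _ _⟩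
    by_cases hD : n 1 + n 2 + n 3 ≤ n 0
    · refine finish 0 fun a b c d => ?_
      rcases two a with rfl | rfl <;> rcases two b with rfl | rfl <;>
        rcases two c with rfl | rfl <;> rcases two d with rfl | rfl <;>
        simp [weight, Fin.sum_univ_four, Killed] <;> linarith
    by_cases hB : n 1 + n 2 ≤ n 0 + n 3
    · refine finish 1 fun a b c d => ?_
      rcases two a with rfl | rfl <;> rcases two b with rfl | rfl <;>
        rcases two c with rfl | rfl <;> rcases two d with rfl | rfl <;>
        simp [weight, Fin.sum_univ_four, Killed] <;> linarith
    · refine finish 2 fun a b c d => ?_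
      rcases two a with rfl | rfl <;> rcases two b with rfl | rfl <;>
        rcases two c with rfl | rfl <;> rcases two d with rfl | rfl <;>
        simp [weight, Fin.sum_univ_four, Killed] <;> linarith
  have hmono := Tuple.monotone_sort (-m)
  set σ := Tuple.sort (-m)
  obtain ⟨t, ht⟩ := key (m ∘ σ) (fun k => hm _)
    (by simpa using hmono (show (0 : Fin 4) ≤ 1 by decide))
    (by simpa using hmono (show (1 : Fin 4) ≤ 2 by decide))
    (by simpa using hmono (show (2 : Fin 4) ≤ 3 by decide))
  refine ⟨σ.symm, t, fun i hi => (ht i hi).trans_eq ?_⟩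
  exact Fintype.sum_equiv σ _ _ fun k => by simp

/-- A nonzero hypermatrix with `0` in the closure of its orbit has a normal form. -/
theorem good_of_mem_closure {T : V} (hT : T ≠ 0) (h : (0 : V) ∈ closure (orbitG T)) :
    Good T := by
  classical
  by_contra hgood
  set R : (Fin 4 → ℝ) → V := fun φ => actG (ofFactor fun k => rot (φ k)) T
  set F : Equiv.Perm (Fin 4) × Fin 3 → (Fin 4 → ℝ) → ℝ := fun p φ =>
    ∑ i, if Killed p.2 i then |coord (R φ) (i ∘ p.1)| else 0
  have hcont : ∀ p, Continuous (F p) := by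
    intro p
    refine continuous_finsetSum _ fun i _ => ?_
    split_ifs
    · refine Continuous.abs ?_
      simp only [R, coord_actG, factor_ofFactor]
      refine continuous_finsetSum _ fun j _ => Continuous.mul ?_ continuous_const
      refine continuous_finsetProd _ fun k _ => ?_
      generalize (i ∘ p.1) k = a
      generalize j k = b
      fin_cases a <;> fin_cases b <;> simp [rot, sl] <;> fun_prop
    · exact continuous_const
  have hpos : ∀ p φ, 0 < F p φ := by
    intro p φ
    have hterm : ∀ i ∈ Finset.univ, (0 : ℝ) ≤
        if Killed p.2 i then |coord (R φ) (i ∘ p.1)| else 0 := by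
      intro i _
      split_ifs <;> positivity
    refine (Finset.sum_nonneg hterm).lt_of_ne' fun h0 => hgood ?_
    have h0 := (Finset.sum_eq_zero_iff_of_nonneg hterm).1 h0
    have hE : Equ T (R φ) := ⟨_, rfl⟩
    refine hE.good (good_of_perm p.1 ?_)
    refine good_of_killed (fun hz => hE.ne_zero hT ?_) p.2 fun i hi => ?_
    · have := congr_arg (perm p.1⁻¹) hz
      rw [perm_perm, inv_mul_cancel, perm_one] at this
      exact this
    · simpa [hi, coord_perm] using h0 i (Finset.mem_univ i)
  have hmin : ∀ p, ∃ δ > 0, ∀ φ ∈ Set.Icc (0 : Fin 4 → ℝ) (fun _ => Real.pi), δ ≤ F p φ := by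
    intro p
    obtain ⟨φ, -, hφ⟩ :=
      (isCompact_Icc (a := (0 : Fin 4 → ℝ)) (b := fun _ => Real.pi)).exists_isMinOn
      ⟨0, le_rfl, fun _ => Real.pi_pos.le⟩ (hcont p).continuousOn
    exact ⟨F p φ, hpos p φ, fun ψ hψ => hφ hψ⟩
  choose δ hδ0 hδ using hmin
  obtain ⟨p₀, hp₀⟩ := Finite.exists_min δ
  obtain ⟨S, ⟨g, rfl⟩, hS⟩ := Metric.mem_closure_iff.1 h (δ p₀ / 512)
    (by have := hδ0 p₀; positivity)
  obtain ⟨g, rfl⟩ := ofFactor_surjective g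
  have hsmall : ∀ i, |coord (actG (ofFactor g) T) i| ≤ δ p₀ / 512 := by
    intro i
    rw [dist_comm, dist_zero_right] at hS
    exact (((norm_le_pi_norm (actG (ofFactor g) T (i 0) (i 1) (i 2)) (i 3)).trans
      (norm_le_pi_norm (actG (ofFactor g) T (i 0) (i 1)) (i 2))).trans
      ((norm_le_pi_norm (actG (ofFactor g) T (i 0)) (i 1)).trans
      (norm_le_pi_norm (actG (ofFactor g) T) (i 0)))).trans hS.le
  choose φ hφ m hm k hk hkg using fun f => exists_svd (g f)
  obtain ⟨e, t, het⟩ := exists_killed_weight hm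
  have heq : actG (ofFactor k) (actG (ofFactor g) T) =
      actG (ofFactor fun f => slExp (-m f)) (R φ) := by
    rw [← actG_mul, ← actG_mul]
    congr 1
    simp only [ofFactor, Prod.mk_mul_mk, hkg]
  have hle := hδ (e, t) φ ⟨fun f => (hφ f).1, fun f => (hφ f).2⟩
  have hlt : F (e, t) φ < δ p₀ := by
    refine (Finset.sum_le_card_nsmul _ _ (16 * (δ p₀ / 512)) fun i _ => ?_).trans_lt ?_
    · have h0 := abs_coord_actG_le hk hsmall (i ∘ e)
      split_ifs with hi
      · rw [heq, coord_actG_slExp, abs_mul, Real.abs_exp] at h0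
        exact (le_mul_of_one_le_left (abs_nonneg _) (Real.one_le_exp (het i hi))).trans h0
      · exact (abs_nonneg _).trans h0
    · have := hδ0 p₀
      simp
      linarith
  linarith [hp₀ (e, t)]

/-! ### The normal forms are nilpotent -/

/-- Some one-parameter subgroup of diagonal matrices contracts the hypermatrix to zero. -/
def Unstable (T : V) : Prop :=
  ∃ l : Fin 4 → ℤ, ∀ i, coord T i ≠ 0 → 0 < ∑ k, ![l k, -l k] (i k)

lemma Unstable.zero_mem_closure {T : V} : Unstable T → (0 : V) ∈ closure (orbitG T) := by
  rintro ⟨l, hl⟩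
  have hw : ∀ i, weight (fun k => (l k : ℝ)) i = ((∑ k, ![l k, -l k] (i k) : ℤ) : ℝ) := by
    intro i
    rw [weight, Int.cast_sum]
    refine Finset.sum_congr rfl fun k _ => ?_
    generalize i k = a
    fin_cases a <;> simp
  refine mem_closure_of_tendsto (f := fun n : ℕ =>
    actG (ofFactor fun k => slExp ((-n : ℝ) * l k)) T) (b := Filter.atTop) ?_
    (.of_forall fun n => ⟨_, rfl⟩)
  have key : ∀ i, Filter.Tendsto (fun n : ℕ =>
      coord (actG (ofFactor fun k => slExp ((-n : ℝ) * l k)) T) i) Filter.atTop (nhds 0) := by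
    intro i
    simp only [coord_actG_slExp]
    have hw' : ∀ n : ℕ, weight (fun k => (-n : ℝ) * l k) i =
        -((weight (fun k => (l k : ℝ)) i) * n) := by
      intro n
      rw [weight, weight, Finset.sum_mul, ← Finset.sum_neg_distrib]
      refine Finset.sum_congr rfl fun k _ => ?_
      generalize i k = a
      fin_cases a <;> simp <;> ring
    by_cases hz : coord T i = 0
    · simp [hz]
    · have hpos : 0 < weight (fun k => (l k : ℝ)) i := by
        rw [hw]; exact_mod_cast hl i hz
      simp only [hw']
      simpa using (Real.tendsto_exp_neg_atTop_nhds_zero.comp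
        (tendsto_natCast_atTop_atTop.const_mul_atTop hpos)).mul_const (coord T i)
  simp only [tendsto_pi_nhds]
  intro a b c d
  exact key ![a, b, c, d]

lemma Unstable.perm {T : V} (e : Equiv.Perm (Fin 4)) : Unstable T → Unstable (perm e T) := by
  rintro ⟨l, hl⟩
  refine ⟨l ∘ e.symm, fun i hi => ?_⟩
  rw [coord_perm] at hi
  refine (hl _ hi).trans_eq (Fintype.sum_equiv e _ _ fun k => by simp)

lemma coord_wForm_ne_zero {s : Fin 4 → SignType} {i : Fin 4 → Fin 2}
    (h : coord (wForm fun k => (s k : ℝ)) i ≠ 0) : ∃ k, s k ≠ 0 ∧ ∀ j, i j = 1 ↔ j = k := by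
  rw [wForm, coord_ofCoord] at h
  obtain ⟨k, -, hk⟩ := Finset.exists_ne_zero_of_sum_ne_zero h
  split_ifs at hk with hi
  · exact ⟨k, fun h0 => hk (by simp [h0]), hi⟩
  · exact absurd rfl hk

lemma coord_cForm_ne_zero {s : Fin 4 → SignType} {i : Fin 4 → Fin 2}
    (h : coord (cForm s) i ≠ 0) : ∃ k, s k ≠ 0 ∧ ∀ j, i j = 1 ↔ s j ≠ 0 ∧ j ≠ k := by
  rw [cForm, coord_ofCoord] at h
  obtain ⟨k, -, hk⟩ := Finset.exists_ne_zero_of_sum_ne_zero h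
  split_ifs at hk with hi
  · exact ⟨k, fun h0 => hk (by simp [h0]), hi⟩
  · exact absurd rfl hk

lemma coord_unitForm_ne_zero {p : Fin 4 → Prop} [DecidablePred p] {i : Fin 4 → Fin 2}
    (h : coord (unitForm p) i ≠ 0) : ∀ j, i j = 1 ↔ p j := by
  rw [unitForm, coord_ofCoord] at h
  by_contra h'
  exact h (if_neg h')

lemma coord_mForm_ne_zero {f : Fin 4} {u : Fin 4 → Fin 2 → ℝ} {i : Fin 4 → Fin 2}
    (h : coord (mForm f u) i ≠ 0) : ∃ k, k ≠ f ∧ ∀ j, j ≠ f → (i j = 1 ↔ j = k) := by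
  rw [mForm, coord_ofCoord] at h
  obtain ⟨k, -, hk⟩ := Finset.exists_ne_zero_of_sum_ne_zero h
  by_contra h'
  exact hk (if_neg fun h0 => h' ⟨k, h0⟩)

lemma coord_add_ne_zero {S T : V} {i : Fin 4 → Fin 2} (h : coord (S + T) i ≠ 0) :
    coord S i ≠ 0 ∨ coord T i ≠ 0 := by
  by_contra! h0
  exact h (show coord S i + coord T i = 0 by rw [h0.1, h0.2, add_zero])

lemma unstable_mForm (f : Fin 4) (u : Fin 4 → Fin 2 → ℝ) : Unstable (mForm f u) := by
  have key : ∀ f k : Fin 4, ∀ i : Fin 4 → Fin 2, k ≠ f → (∀ j, j ≠ f → (i j = 1 ↔ j = k)) →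
      0 < ∑ k, ![if k = f then (0 : ℤ) else 1, -if k = f then (0 : ℤ) else 1] (i k) := by
    decide +kernel
  refine ⟨fun k => if k = f then 0 else 1, fun i hi => ?_⟩
  obtain ⟨k, hk, h⟩ := coord_mForm_ne_zero hi
  exact key f k i hk h

lemma unstable_rep {κ : Kind} {s : Fin 4 → SignType} (h : Valid κ s) : Unstable (rep κ s) := by
  cases κ
  case w =>
    have key : ∀ k : Fin 4, ∀ i : Fin 4 → Fin 2, (∀ j, i j = 1 ↔ j = k) →
        0 < ∑ k, ![(1 : ℤ), -1] (i k) := by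
      decide +kernel
    refine ⟨fun _ => 1, fun i hi => ?_⟩
    obtain ⟨k, -, hk⟩ := coord_wForm_ne_zero hi
    exact key k i hk
  case tri => exact (unstable_mForm _ _).perm _
  case ghz =>
    have key : ∀ s, Valid .ghz s → ∀ i : Fin 4 → Fin 2,
        (∀ j, i j = 1 ↔ False) ∨ (∀ j, i j = 1 ↔ s j = 0) →
        0 < ∑ k, ![if s k = 0 then (0 : ℤ) else 1, -if s k = 0 then (0 : ℤ) else 1] (i k) := by
      decide +kernel
    refine ⟨_, fun i hi => key s h i ((coord_add_ne_zero hi).imp ?_ ?_)⟩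
    · exact coord_unitForm_ne_zero
    · exact coord_unitForm_ne_zero
  case re =>
    have key : ∀ s, Valid .re s → ∀ i : Fin 4 → Fin 2,
        (∀ j, i j = 1 ↔ False) ∨ (∃ k, s k ≠ 0 ∧ ∀ j, i j = 1 ↔ s j ≠ 0 ∧ j ≠ k) →
        0 < ∑ k, ![if s k = 0 then (1 : ℤ) else 0, -if s k = 0 then (1 : ℤ) else 0] (i k) := by
      decide +kernel
    refine ⟨_, fun i hi => key s h i ((coord_add_ne_zero hi).imp ?_ ?_)⟩
    · exact coord_unitForm_ne_zero
    · exact coord_cForm_ne_zero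
  case pair =>
    have key : ∀ s, Valid .pair s → ∀ i : Fin 4 → Fin 2,
        (∃ k, s k ≠ 0 ∧ ∀ j, i j = 1 ↔ j = k) ∨ (∀ j, i j = 1 ↔ s j = 0) →
        0 < ∑ k, ![if s k = 0 then (1 : ℤ) else 2, -if s k = 0 then (1 : ℤ) else 2] (i k) := by
      decide +kernel
    refine ⟨_, fun i hi => key s h i ((coord_add_ne_zero hi).imp ?_ ?_)⟩
    · exact coord_wForm_ne_zero
    · exact coord_unitForm_ne_zero
  case cross =>
    have key : ∀ s, Valid .cross s → ∀ i : Fin 4 → Fin 2,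
        (∀ j, i j = 1 ↔ s j = 0) ∨ (∃ k, s k ≠ 0 ∧ ∀ j, i j = 1 ↔ s j ≠ 0 ∧ j ≠ k) →
        0 < ∑ k, ![if s k = 0 then (2 : ℤ) else 1, -if s k = 0 then (2 : ℤ) else 1] (i k) := by
      decide +kernel
    refine ⟨_, fun i hi => key s h i ((coord_add_ne_zero hi).imp ?_ ?_)⟩
    · exact coord_unitForm_ne_zero
    · exact coord_cForm_ne_zero

/-! ### Invariants of orbits -/

/-- The determinant of the matrix obtained by contracting the last two factors with vectors. -/
def pairDet (T : V) (x y : Fin 2 → ℝ) : ℝ :=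
  (Matrix.of fun a b => ∑ c, ∑ d, T a b c d * x c * y d).det

lemma pairDet_actG (g : G) (T : V) (x y : Fin 2 → ℝ) :
    pairDet (actG g T) x y = pairDet T (x ᵥ* g.2.2.1) (y ᵥ* g.2.2.2) := by
  have : (Matrix.of fun a b => ∑ c, ∑ d, actG g T a b c d * x c * y d) =
      g.1 * (Matrix.of fun a b => ∑ c, ∑ d, T a b c d * (x ᵥ* g.2.2.1) c * (y ᵥ* g.2.2.2) d) *
        (g.2.1 : Matrix (Fin 2) (Fin 2) ℝ)ᵀ := by
    ext a b
    simp only [actG, Matrix.of_apply, Matrix.mul_apply, Matrix.transpose_apply,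
      Matrix.vecMul, dotProduct, Fin.sum_univ_two]
    ring
  rw [pairDet, this, det_mul, det_mul, det_transpose, g.1.2, g.2.1.2, one_mul, mul_one, pairDet]

/-- The cyclic rotation of the first three factors. -/
def rotate (T : V) : V := fun a b c d => T c a b d

lemma rotate_actG (g : G) (T : V) :
    rotate (actG g T) = actG (g.2.1, g.2.2.1, g.1, g.2.2.2) (rotate T) := by
  funext a b c d
  simp only [rotate, actG, Fin.sum_univ_two]
  ring

/-- The polarization of a function. -/
def polar (q : (Fin 2 → ℝ) → ℝ) (s t : Fin 2 → ℝ) : ℝ := q (s + t) - q s - q t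

/-- The Jacobian, in the last factor, of two of the quadratic forms `pairDet`. -/
def jac (T : V) (p r s t : Fin 2 → ℝ) : ℝ :=
  pairDet T r s * polar (pairDet (rotate T) p) s t -
    polar (pairDet T r) s t * pairDet (rotate T) p s

lemma jac_actG (g : G) (T : V) (p r s t : Fin 2 → ℝ) :
    jac (actG g T) p r s t =
      jac T (p ᵥ* g.1) (r ᵥ* g.2.2.1) (s ᵥ* g.2.2.2) (t ᵥ* g.2.2.2) := by
  simp only [jac, polar, rotate_actG, pairDet_actG, Matrix.add_vecMul]

lemma br_vecMul (g : Matrix.SpecialLinearGroup (Fin 2) ℝ) (s t : Fin 2 → ℝ) :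
    br (s ᵥ* g) (t ᵥ* g) = br s t := by
  have hdet : g 0 0 * g 1 1 - g 0 1 * g 1 0 = 1 := by
    rw [← Matrix.det_fin_two]; exact g.2
  simp only [br, Matrix.vecMul, dotProduct, Fin.sum_univ_two]
  linear_combination (s 0 * t 1 - s 1 * t 0) * hdet

/-- The form `pairDet` takes a value of the sign of `ε`. -/
def PairSign (ε : ℝ) (T : V) : Prop := ∃ x y, 0 < ε * pairDet T x y

/-- For some value of the second argument, `pairDet` is anisotropic in the first. -/
def PairAnisotropic (T : V) : Prop := ∃ y, ∀ x, x ≠ 0 → pairDet T x y ≠ 0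

/-- For some oriented basis in the last factor, `jac` is semidefinite of the sign of `ε`. -/
def JacSign (ε : ℝ) (T : V) : Prop :=
  ∃ s t, br s t = 1 ∧ (∀ p r, 0 ≤ ε * jac T p r s t) ∧ ∃ p r, 0 < ε * jac T p r s t

lemma Equ.pairSign {ε : ℝ} {S T : V} (h : Equ S T) (hT : PairSign ε T) : PairSign ε S := by
  obtain ⟨g, rfl⟩ := h
  obtain ⟨x, y, hxy⟩ := hT
  exact ⟨_, _, by rwa [pairDet_actG] at hxy⟩

lemma vecMul_inv_cancel (g : Matrix.SpecialLinearGroup (Fin 2) ℝ) (x : Fin 2 → ℝ) :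
    (x ᵥ* (g⁻¹ : Matrix.SpecialLinearGroup (Fin 2) ℝ).1) ᵥ* g.1 = x := by
  rw [Matrix.vecMul_vecMul, ← Matrix.SpecialLinearGroup.coe_mul, inv_mul_cancel,
    Matrix.SpecialLinearGroup.coe_one, Matrix.vecMul_one]

lemma Equ.pairAnisotropic {S T : V} (h : Equ S T) (hT : PairAnisotropic T) :
    PairAnisotropic S := by
  obtain ⟨g, rfl⟩ := h
  obtain ⟨y, hy⟩ := hT
  refine ⟨y ᵥ* g.2.2.2, fun x hx => ?_⟩
  have := hy (x ᵥ* (g.2.2.1⁻¹ : Matrix.SpecialLinearGroup (Fin 2) ℝ).1) fun h0 => hx <| by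
    rw [← vecMul_inv_cancel g.2.2.1 x, h0, Matrix.zero_vecMul]
  rwa [pairDet_actG, vecMul_inv_cancel] at this

lemma Equ.jacSign {ε : ℝ} {S T : V} (h : Equ S T) (hT : JacSign ε T) : JacSign ε S := by
  obtain ⟨g, rfl⟩ := h
  obtain ⟨s, t, hst, hle, p, r, hpr⟩ := hT
  refine ⟨s ᵥ* g.2.2.2, t ᵥ* g.2.2.2, by rwa [br_vecMul], fun p r => ?_, _, _,
    by rwa [jac_actG] at hpr⟩
  have := hle (p ᵥ* (g.1⁻¹ : Matrix.SpecialLinearGroup (Fin 2) ℝ).1)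
    (r ᵥ* (g.2.2.1⁻¹ : Matrix.SpecialLinearGroup (Fin 2) ℝ).1)
  rwa [jac_actG, vecMul_inv_cancel, vecMul_inv_cancel] at this

/-- No value of `JacSign` holds. -/
def JacNeutral (T : V) : Prop := ∀ ε, ¬ JacSign ε T

lemma jacNeutral_of_neg {T : V}
    (h : ∀ p r s t, ∃ p' r', jac T p' r' s t = -jac T p r s t) : JacNeutral T := by
  rintro ε ⟨s, t, -, hle, p, r, hpr⟩
  obtain ⟨p', r', h'⟩ := h p r s t
  have := hle p' r'
  rw [h', mul_neg] at this
  linarith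

lemma jacNeutral_of_eq_zero {T : V} (h : ∀ p r s t, jac T p r s t = 0) : JacNeutral T :=
  jacNeutral_of_neg fun p r s t => ⟨p, r, by rw [h, neg_zero]⟩

lemma Equ.jacNeutral {S T : V} (h : Equ S T) (hT : JacNeutral T) : JacNeutral S :=
  fun ε hε => hT ε (h.symm.jacSign hε)

lemma sq_signType {a : SignType} (h : a ≠ 0) : (a : ℝ) ^ 2 = 1 := by
  cases a <;> simp at h ⊢

section Evaluation

lemma jacSign_iff_of_sq {T : V} {c : ℝ} (f : (Fin 2 → ℝ) → (Fin 2 → ℝ) → (Fin 2 → ℝ) → ℝ)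
    (h : ∀ p r s t, jac T p r s t = c * br s t * f p r s ^ 2) {p r s t : Fin 2 → ℝ}
    (hst : br s t = 1) (hf : f p r s ≠ 0) (ε : ℝ) : JacSign ε T ↔ 0 < ε * c := by
  refine ⟨?_, fun hc => ⟨s, t, hst, fun p r => ?_, p, r, ?_⟩⟩
  · rintro ⟨s, t, hst, -, p, r, hpr⟩
    rw [h, hst, mul_one, ← mul_assoc] at hpr
    exact pos_of_mul_pos_left hpr (sq_nonneg _)
  · rw [h, hst, mul_one, ← mul_assoc]
    positivity
  · rw [h, hst, mul_one, ← mul_assoc]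
    positivity

variable {s : Fin 4 → SignType}

lemma pairDet_w (s : Fin 4 → SignType) (x y : Fin 2 → ℝ) :
    pairDet (rep .w s) x y = -((s 0 : ℝ) * (s 1 : ℝ)) * (x 0 * y 0) ^ 2 := by
  simp [pairDet, det_fin_two, Fin.sum_univ_two, rep, wForm, ofCoord, Fin.sum_univ_four,
    Fin.forall_fin_succ]
  ring

lemma jacNeutral_w (s : Fin 4 → SignType) : JacNeutral (rep .w s) := by
  have h : ∀ x y, pairDet (rotate (rep .w s)) x y =
      -((s 1 : ℝ) * (s 2 : ℝ)) * (x 0 * y 0) ^ 2 := by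
    intro x y
    simp [pairDet, rotate, det_fin_two, Fin.sum_univ_two, rep, wForm, ofCoord,
      Fin.sum_univ_four, Fin.forall_fin_succ]
    ring
  refine jacNeutral_of_eq_zero fun p r σ τ => ?_
  simp only [jac, polar, pairDet_w, h, Pi.add_apply]
  ring

lemma pairDet_ghz_three (h0 : s 0 = 0) (h1 : s 1 = 0) (h2 : s 2 = 0) (h3 : s 3 ≠ 0)
    (x y : Fin 2 → ℝ) : pairDet (rep .ghz s) x y = x 0 * x 1 * y 0 ^ 2 := by
  simp [pairDet, det_fin_two, Fin.sum_univ_two, rep, unitForm, ofCoord, Fin.forall_fin_succ,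
    h0, h1, h2, h3]
  ring

lemma pairDet_ghz_eq_zero (h : s 0 ≠ 0 ∨ s 1 ≠ 0) (x y : Fin 2 → ℝ) :
    pairDet (rep .ghz s) x y = 0 := by
  rcases h with h | h <;>
    simp [pairDet, det_fin_two, Fin.sum_univ_two, rep, unitForm, ofCoord, Fin.forall_fin_succ, h]

lemma jacNeutral_ghz (h : Valid .ghz s) : JacNeutral (rep .ghz s) := by
  have key : ∀ s, Valid .ghz s → (s 0 = 0 ∧ s 1 = 0 ∧ s 2 = 0 ∧ s 3 ≠ 0) ∨
      (s 0 ≠ 0 ∨ s 1 ≠ 0) ∨ s 2 ≠ 0 := by decide +kernel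
  refine jacNeutral_of_eq_zero fun p r σ τ => ?_
  rcases key s h with ⟨h0, h1, h2, h3⟩ | h | h
  · have h' : ∀ x y, pairDet (rotate (rep .ghz s)) x y = x 0 * x 1 * y 0 ^ 2 := by
      intro x y
      simp [pairDet, rotate, det_fin_two, Fin.sum_univ_two, rep, unitForm, ofCoord,
        Fin.forall_fin_succ, h0, h1, h2, h3]
      ring
    simp only [jac, polar, pairDet_ghz_three h0 h1 h2 h3, h', Pi.add_apply]
    ring
  · simp [jac, polar, pairDet_ghz_eq_zero h]
  · have h' : ∀ x y, pairDet (rotate (rep .ghz s)) x y = 0 := by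
      intro x y
      simp [pairDet, rotate, det_fin_two, Fin.sum_univ_two, rep, unitForm, ofCoord,
        Fin.forall_fin_succ, h]
    simp [jac, polar, h']

lemma pairDet_re_three (h0 : s 0 ≠ 0) (h1 : s 1 ≠ 0) (h2 : s 2 ≠ 0) (h3 : s 3 = 0)
    (x y : Fin 2 → ℝ) : pairDet (rep .re s) x y =
      ((s 2 : ℝ) * x 0 ^ 2 - (s 0 : ℝ) * (s 1 : ℝ) * x 1 ^ 2) * y 0 ^ 2 := by
  simp [pairDet, det_fin_two, Fin.sum_univ_two, rep, cForm, unitForm, ofCoord,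
    Fin.sum_univ_four, Fin.forall_fin_succ, h0, h1, h2, h3]
  ring

lemma pairDet_re_two (h0 : s 0 ≠ 0) (h1 : s 1 ≠ 0) (h2 : s 2 = 0) (h3 : s 3 ≠ 0)
    (x y : Fin 2 → ℝ) : pairDet (rep .re s) x y =
      ((s 3 : ℝ) * y 0 ^ 2 - (s 0 : ℝ) * (s 1 : ℝ) * y 1 ^ 2) * x 0 ^ 2 := by
  simp [pairDet, det_fin_two, Fin.sum_univ_two, rep, cForm, unitForm, ofCoord,
    Fin.sum_univ_four, Fin.forall_fin_succ, h0, h1, h2, h3]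
  ring

lemma pairDet_re_eq_zero (h : s 0 = 0 ∨ s 1 = 0) (x y : Fin 2 → ℝ) :
    pairDet (rep .re s) x y = 0 := by
  rcases h with h | h <;>
    simp [pairDet, det_fin_two, Fin.sum_univ_two, rep, cForm, unitForm, ofCoord,
      Fin.sum_univ_four, Fin.forall_fin_succ, h]

lemma jacNeutral_re (h : Valid .re s) : JacNeutral (rep .re s) := by
  have key : ∀ s, Valid .re s → (s 0 ≠ 0 ∧ s 1 ≠ 0 ∧ s 2 ≠ 0 ∧ s 3 = 0) ∨
      (s 0 = 0 ∨ s 1 = 0) ∨ s 2 = 0 := by decide +kernel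
  refine jacNeutral_of_eq_zero fun p r σ τ => ?_
  rcases key s h with ⟨h0, h1, h2, h3⟩ | h | h
  · have h' : ∀ x y, pairDet (rotate (rep .re s)) x y =
        ((s 0 : ℝ) * x 0 ^ 2 - (s 1 : ℝ) * (s 2 : ℝ) * x 1 ^ 2) * y 0 ^ 2 := by
      intro x y
      simp [pairDet, rotate, det_fin_two, Fin.sum_univ_two, rep, cForm, unitForm, ofCoord,
        Fin.sum_univ_four, Fin.forall_fin_succ, h0, h1, h2, h3]
      ring
    simp only [jac, polar, pairDet_re_three h0 h1 h2 h3, h', Pi.add_apply]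
    ring
  · simp [jac, polar, pairDet_re_eq_zero h]
  · have h' : ∀ x y, pairDet (rotate (rep .re s)) x y = 0 := by
      intro x y
      simp [pairDet, rotate, det_fin_two, Fin.sum_univ_two, rep, cForm, unitForm, ofCoord,
        Fin.sum_univ_four, Fin.forall_fin_succ, h]
    simp [jac, polar, h']

lemma jacSign_pair_iff (h0 : s 0 = 0) (h1 : s 1 ≠ 0) (h2 : s 2 ≠ 0) (h3 : s 3 = 0) :
    ∀ ε : ℝ, JacSign ε (rep .pair s) ↔ 0 < ε * -(s 2 : ℝ) := by
  have d : ∀ x y, pairDet (rep .pair s) x y =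
      -((s 1 : ℝ) * x 0 ^ 2 * y 0 * y 1) := by
    intro x y
    simp [pairDet, det_fin_two, Fin.sum_univ_two, rep, wForm, unitForm, ofCoord,
      Fin.sum_univ_four, Fin.forall_fin_succ, h0, h1, h2, h3]
    ring
  have d' : ∀ x y, pairDet (rotate (rep .pair s)) x y =
      -((s 1 : ℝ) * (s 2 : ℝ) * x 0 ^ 2 * y 0 ^ 2) := by
    intro x y
    simp [pairDet, rotate, det_fin_two, Fin.sum_univ_two, rep, wForm, unitForm, ofCoord,
      Fin.sum_univ_four, Fin.forall_fin_succ, h0, h1, h2, h3]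
    ring
  have h1' : (s 1 : ℝ) ^ 2 = 1 := sq_signType h1
  refine jacSign_iff_of_sq (fun p r σ => p 0 * r 0 * σ 0) (fun p r σ τ => ?_)
    (p := ![1, 0]) (r := ![1, 0]) (s := ![1, 0]) (t := ![0, 1]) (by simp [br]) (by simp)
  simp only [jac, polar, br, d, d', Pi.add_apply]
  linear_combination (-(s 2 : ℝ) * (σ 0 * τ 1 - σ 1 * τ 0) * (p 0 * r 0 * σ 0) ^ 2) * h1'

lemma jacNeutral_pair_zero_two (h0 : s 0 ≠ 0) (h1 : s 1 = 0) (h2 : s 2 ≠ 0) (h3 : s 3 = 0) :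
    JacNeutral (rep .pair s) := by
  have d : ∀ x y, pairDet (rep .pair s) x y =
      -((s 0 : ℝ) * x 0 ^ 2 * y 0 * y 1) := by
    intro x y
    simp [pairDet, det_fin_two, Fin.sum_univ_two, rep, wForm, unitForm, ofCoord,
      Fin.sum_univ_four, Fin.forall_fin_succ, h0, h1, h2, h3]
    ring
  have d' : ∀ x y, pairDet (rotate (rep .pair s)) x y =
      -((s 2 : ℝ) * x 0 ^ 2 * y 0 * y 1) := by
    intro x y
    simp [pairDet, rotate, det_fin_two, Fin.sum_univ_two, rep, wForm, unitForm, ofCoord,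
      Fin.sum_univ_four, Fin.forall_fin_succ, h0, h1, h2, h3]
    ring
  refine jacNeutral_of_eq_zero fun p r σ τ => ?_
  simp only [jac, polar, d, d', Pi.add_apply]
  ring

lemma jacNeutral_pair_one_three (h0 : s 0 = 0) (h1 : s 1 ≠ 0) (h2 : s 2 = 0) (h3 : s 3 ≠ 0) :
    JacNeutral (rep .pair s) := by
  have d : ∀ x y, pairDet (rep .pair s) x y =
      -((s 1 : ℝ) * x 0 * x 1 * y 0 ^ 2) := by
    intro x y
    simp [pairDet, det_fin_two, Fin.sum_univ_two, rep, wForm, unitForm, ofCoord,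
      Fin.sum_univ_four, Fin.forall_fin_succ, h0, h1, h2, h3]
    ring
  have d' : ∀ x y, pairDet (rotate (rep .pair s)) x y =
      -((s 1 : ℝ) * x 0 * x 1 * y 0 ^ 2) := by
    intro x y
    simp [pairDet, rotate, det_fin_two, Fin.sum_univ_two, rep, wForm, unitForm, ofCoord,
      Fin.sum_univ_four, Fin.forall_fin_succ, h0, h1, h2, h3]
    ring
  refine jacNeutral_of_neg fun p r σ τ => ⟨p, ![r 0, -r 1], ?_⟩
  simp only [jac, polar, d, d', Pi.add_apply, cons_val_zero, cons_val_one]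
  ring

lemma jacNeutral_pair_zero_three (h0 : s 0 ≠ 0) (h1 : s 1 = 0) (h2 : s 2 = 0) (h3 : s 3 ≠ 0) :
    JacNeutral (rep .pair s) := by
  have d : ∀ x y, pairDet (rep .pair s) x y =
      -((s 0 : ℝ) * x 0 * x 1 * y 0 ^ 2) := by
    intro x y
    simp [pairDet, det_fin_two, Fin.sum_univ_two, rep, wForm, unitForm, ofCoord,
      Fin.sum_univ_four, Fin.forall_fin_succ, h0, h1, h2, h3]
    ring
  have d' : ∀ x y, pairDet (rotate (rep .pair s)) x y =
      x 0 * y 0 * ((s 0 : ℝ) * x 1 * y 0 + (s 3 : ℝ) * x 0 * y 1) := by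
    intro x y
    simp [pairDet, rotate, det_fin_two, Fin.sum_univ_two, rep, wForm, unitForm, ofCoord,
      Fin.sum_univ_four, Fin.forall_fin_succ, h0, h1, h2, h3]
    ring
  refine jacNeutral_of_neg fun p r σ τ => ⟨p, ![r 0, -r 1], ?_⟩
  simp only [jac, polar, d, d', Pi.add_apply, cons_val_zero, cons_val_one]
  ring

lemma jacSign_cross_iff (h0 : s 0 = 0) (h1 : s 1 ≠ 0) (h2 : s 2 ≠ 0) (h3 : s 3 ≠ 0) :
    ∀ ε : ℝ, JacSign ε (rep .cross s) ↔ 0 < ε * (s 1 : ℝ) := by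
  have d : ∀ x y, pairDet (rep .cross s) x y =
      -((s 2 : ℝ) * x 0 * y 1 + (s 3 : ℝ) * x 1 * y 0) * (x 0 * y 0) := by
    intro x y
    simp [pairDet, det_fin_two, Fin.sum_univ_two, rep, cForm, unitForm, ofCoord,
      Fin.sum_univ_four, Fin.forall_fin_succ, h0, h1, h2, h3]
    ring
  have d' : ∀ x y, pairDet (rotate (rep .cross s)) x y =
      (s 3 : ℝ) * x 0 * x 1 * y 0 ^ 2 - (s 1 : ℝ) * (s 2 : ℝ) * x 0 ^ 2 * y 1 ^ 2 := by
    intro x y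
    simp [pairDet, rotate, det_fin_two, Fin.sum_univ_two, rep, cForm, unitForm, ofCoord,
      Fin.sum_univ_four, Fin.forall_fin_succ, h0, h1, h2, h3]
    ring
  have J : ∀ p r σ τ, jac (rep .cross s) p r σ τ = br σ τ *
      ((s 2 : ℝ) * (s 3 : ℝ) * (r 0 * σ 0) ^ 2 * (p 0 * p 1) +
        2 * (s 1 : ℝ) * (s 2 : ℝ) * (s 3 : ℝ) * p 0 ^ 2 * (r 0 * r 1) * (σ 0 * σ 1) +
        (s 1 : ℝ) * ((s 2 : ℝ) * r 0 * p 0 * σ 1) ^ 2) := by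
    intro p r σ τ
    simp only [jac, polar, br, d, d', Pi.add_apply]
    ring
  have h2' : (s 2 : ℝ) ≠ 0 := signType_cast_eq_zero.not.2 h2
  have h3' : (s 3 : ℝ) ≠ 0 := signType_cast_eq_zero.not.2 h3
  refine fun ε => ⟨?_, fun h => ⟨![0, 1], ![-1, 0], by simp [br], fun p r => ?_,
    ![1, 0], ![1, 0], ?_⟩⟩
  · rintro ⟨σ, τ, hστ, hle, p, r, hpr⟩
    by_cases hσ : σ 0 = 0
    · rw [J, hστ, hσ] at hpr
      refine pos_of_mul_pos_left (b := ((s 2 : ℝ) * r 0 * p 0 * σ 1) ^ 2) ?_ (sq_nonneg _)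
      refine hpr.trans_eq ?_
      ring
    · exfalso
      have hε : ε ≠ 0 := fun h0 => by simp [h0] at hpr
      have := hle ![1, (-ε - (s 1 : ℝ) * ((s 2 : ℝ) * σ 1) ^ 2) /
        ((s 2 : ℝ) * (s 3 : ℝ) * σ 0 ^ 2)] ![1, 0]
      rw [J, hστ] at this
      simp only [cons_val_zero, cons_val_one] at this
      field_simp at this
      have hε' : 0 < ε ^ 2 := by positivity
      nlinarith
  · rw [J]
    simp [br]
    rw [← mul_assoc]
    positivity
  · rw [J]
    simp [br]
    rw [← mul_assoc]
    positivity

lemma jacNeutral_cross_three (h0 : s 0 ≠ 0) (h1 : s 1 ≠ 0) (h2 : s 2 ≠ 0) (h3 : s 3 = 0) :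
    JacNeutral (rep .cross s) := by
  have d : ∀ x y, pairDet (rep .cross s) x y =
      (s 2 : ℝ) * x 0 ^ 2 * y 0 * y 1 - (s 0 : ℝ) * (s 1 : ℝ) * x 1 ^ 2 * y 0 ^ 2 := by
    intro x y
    simp [pairDet, det_fin_two, Fin.sum_univ_two, rep, cForm, unitForm, ofCoord,
      Fin.sum_univ_four, Fin.forall_fin_succ, h0, h1, h2, h3]
    ring
  have d' : ∀ x y, pairDet (rotate (rep .cross s)) x y =
      (s 0 : ℝ) * x 0 ^ 2 * y 0 * y 1 - (s 1 : ℝ) * (s 2 : ℝ) * x 1 ^ 2 * y 0 ^ 2 := by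
    intro x y
    simp [pairDet, rotate, det_fin_two, Fin.sum_univ_two, rep, cForm, unitForm, ofCoord,
      Fin.sum_univ_four, Fin.forall_fin_succ, h0, h1, h2, h3]
    ring
  have h0' : (s 0 : ℝ) ^ 2 = 1 := sq_signType h0
  have h2' : (s 2 : ℝ) ^ 2 = 1 := sq_signType h2
  refine jacNeutral_of_neg fun p r σ τ => ⟨![p 1, p 0], ![r 1, r 0], ?_⟩
  simp only [jac, polar, d, d', Pi.add_apply, cons_val_zero, cons_val_one]
  linear_combination ((σ 0 * τ 1 - σ 1 * τ 0) * σ 0 ^ 2 * (s 1 : ℝ) *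
    (r 0 ^ 2 * p 1 ^ 2 + r 1 ^ 2 * p 0 ^ 2)) * (h2' - h0')

lemma jacNeutral_cross_one (h0 : s 0 ≠ 0) (h1 : s 1 = 0) (h2 : s 2 ≠ 0) (h3 : s 3 ≠ 0) :
    JacNeutral (rep .cross s) := by
  have d : ∀ x y, pairDet (rep .cross s) x y =
      -(x 0 * y 0) * ((s 2 : ℝ) * x 0 * y 1 + (s 3 : ℝ) * x 1 * y 0) := by
    intro x y
    simp [pairDet, det_fin_two, Fin.sum_univ_two, rep, cForm, unitForm, ofCoord,
      Fin.sum_univ_four, Fin.forall_fin_succ, h0, h1, h2, h3]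
  have d' : ∀ x y, pairDet (rotate (rep .cross s)) x y =
      -(x 0 * y 0) * ((s 0 : ℝ) * x 0 * y 1 + (s 3 : ℝ) * x 1 * y 0) := by
    intro x y
    simp [pairDet, rotate, det_fin_two, Fin.sum_univ_two, rep, cForm, unitForm, ofCoord,
      Fin.sum_univ_four, Fin.forall_fin_succ, h0, h1, h2, h3]
    ring
  refine jacNeutral_of_neg fun p r σ τ => ⟨![p 0, -p 1], ![r 0, -r 1], ?_⟩
  simp only [jac, polar, d, d', Pi.add_apply, cons_val_zero, cons_val_one]
  ring

lemma jacSign_mForm_three_iff {u : Fin 4 → Fin 2 → ℝ} (hu : u 1 ≠ 0) :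
    ∀ ε : ℝ, JacSign ε (mForm 3 u) ↔ 0 < ε * br (u 0) (u 2) := by
  have d : ∀ x y, pairDet (mForm 3 u) x y =
      -((u 0 0 * y 0 + u 0 1 * y 1) * (u 1 0 * y 0 + u 1 1 * y 1) * x 0 ^ 2) := by
    intro x y
    simp [pairDet, det_fin_two, Fin.sum_univ_two, mForm, ofCoord,
      Fin.sum_univ_four, Fin.forall_fin_succ, Fin.reduceEq]
    ring
  have d' : ∀ x y, pairDet (rotate (mForm 3 u)) x y =
      -((u 1 0 * y 0 + u 1 1 * y 1) * (u 2 0 * y 0 + u 2 1 * y 1) * x 0 ^ 2) := by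
    intro x y
    simp [pairDet, rotate, det_fin_two, Fin.sum_univ_two, mForm, ofCoord,
      Fin.sum_univ_four, Fin.forall_fin_succ, Fin.reduceEq]
    ring
  obtain ⟨σ, τ, hστ, hσ⟩ : ∃ σ τ, br σ τ = 1 ∧ u 1 0 * σ 0 + u 1 1 * σ 1 ≠ 0 := by
    by_cases h0 : u 1 0 = 0
    · refine ⟨![0, 1], ![-1, 0], by simp [br], fun h1 => hu ?_⟩
      ext i
      fin_cases i <;> simp_all
    · exact ⟨![1, 0], ![0, 1], by simp [br], by simpa using h0⟩
  refine jacSign_iff_of_sq (fun p r σ => p 0 * r 0 * (u 1 0 * σ 0 + u 1 1 * σ 1))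
    (fun p r σ τ => ?_) (p := ![1, 0]) (r := ![1, 0]) hστ (by simpa)
  simp only [jac, polar, br, d, d', Pi.add_apply]
  ring

lemma jacNeutral_mForm_one (u : Fin 4 → Fin 2 → ℝ) : JacNeutral (mForm 1 u) := by
  have d : ∀ x y, pairDet (mForm 1 u) x y =
      (br (u 2) (u 0) * x 1 * y 0 + br (u 3) (u 0) * x 0 * y 1) * (x 0 * y 0) := by
    intro x y
    simp [pairDet, det_fin_two, Fin.sum_univ_two, mForm, br, ofCoord,
      Fin.sum_univ_four, Fin.forall_fin_succ, Fin.reduceEq]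
    ring
  have d' : ∀ x y, pairDet (rotate (mForm 1 u)) x y =
      (br (u 0) (u 2) * x 1 * y 0 + br (u 3) (u 2) * x 0 * y 1) * (x 0 * y 0) := by
    intro x y
    simp [pairDet, rotate, det_fin_two, Fin.sum_univ_two, mForm, br, ofCoord,
      Fin.sum_univ_four, Fin.forall_fin_succ, Fin.reduceEq]
    ring
  refine jacNeutral_of_neg fun p r σ τ => ⟨![p 0, -p 1], ![r 0, -r 1], ?_⟩
  simp only [jac, polar, d, d', Pi.add_apply, cons_val_zero, cons_val_one]
  ring

end Evaluation

/-! ### Separation of the normal forms -/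

lemma perm_symm_rep {κ : Kind} (hκ : κ ≠ .tri) (e : Equiv.Perm (Fin 4)) (s : Fin 4 → SignType) :
    perm e.symm (rep κ s) = rep κ (s ∘ e) := by
  rw [perm_rep hκ, Equiv.symm_symm]

lemma Equ.rep_comp {κ κ' : Kind} {s s' : Fin 4 → SignType} (h : Equ (rep κ s) (rep κ' s'))
    (hκ : κ ≠ .tri) (hκ' : κ' ≠ .tri) (e : Equiv.Perm (Fin 4)) :
    Equ (rep κ (s ∘ e)) (rep κ' (s' ∘ e)) := by
  rw [← perm_symm_rep hκ, ← perm_symm_rep hκ']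
  exact h.perm _

lemma signType_eq_of_pos_iff {a b : SignType} (h : ∀ ε : ℝ, 0 < ε * (a : ℝ) ↔ 0 < ε * (b : ℝ)) :
    a = b := by
  have h1 := h 1
  have h2 := h (-1)
  cases a <;> cases b <;> simp at h1 h2 ⊢ <;> linarith

lemma Equ.pairSign_iff {S T : V} (h : Equ S T) (ε : ℝ) : PairSign ε S ↔ PairSign ε T :=
  ⟨h.symm.pairSign, h.pairSign⟩

lemma Equ.jacSign_iff {S T : V} (h : Equ S T) (ε : ℝ) : JacSign ε S ↔ JacSign ε T :=
  ⟨h.symm.jacSign, h.jacSign⟩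

lemma jacSign_self {a : SignType} (ha : a ≠ 0) : (0 : ℝ) < (a : ℝ) * (a : ℝ) :=
  mul_self_pos.2 (signType_cast_eq_zero.not.2 ha)

variable {s s' : Fin 4 → SignType}

lemma not_jacNeutral_pair (h0 : s 0 = 0) (h1 : s 1 ≠ 0) (h2 : s 2 ≠ 0) (h3 : s 3 = 0) :
    ¬ JacNeutral (rep .pair s) := fun h =>
  h (-(s 2 : ℝ)) ((jacSign_pair_iff h0 h1 h2 h3 _).2 (by
    rw [neg_mul_neg]; exact jacSign_self h2))

lemma not_jacNeutral_cross (h0 : s 0 = 0) (h1 : s 1 ≠ 0) (h2 : s 2 ≠ 0) (h3 : s 3 ≠ 0) :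
    ¬ JacNeutral (rep .cross s) := fun h =>
  h (s 1 : ℝ) ((jacSign_cross_iff h0 h1 h2 h3 _).2 (jacSign_self h1))

lemma valid_tri_toLast : ∀ s, Valid .tri s → s (toLast s 0) ≠ 0 ∧ s (toLast s 1) ≠ 0 ∧
    s (toLast s 2) ≠ 0 ∧ s (toLast s 3) = 0 := by
  decide +kernel

lemma perm_rep_tri_eq (e : Equiv.Perm (Fin 4)) (s : Fin 4 → SignType) :
    perm e (rep .tri s) = mForm (e (zeroPos s))
      (signVec (s ∘ toLast s) ∘ (e * toLast s : Equiv.Perm (Fin 4)).symm) := by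
  rw [rep, perm_perm, perm_mForm]
  congr 1
  simp [toLast]

lemma not_jacNeutral_tri (hs : Valid .tri s) {e : Equiv.Perm (Fin 4)} (he : e (zeroPos s) = 3) :
    ¬ JacNeutral (perm e (rep .tri s)) := by
  obtain ⟨h0, h1, h2, -⟩ := valid_tri_toLast s hs
  have hg : Generic (signVec (s ∘ toLast s)) := generic_signVec h0 h1 h2
  rw [perm_rep_tri_eq, he]
  set σ := (e * toLast s : Equiv.Perm (Fin 4)).symm
  have hσ : σ 3 = 3 := by
    rw [Equiv.symm_apply_eq]
    simp [toLast, he]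
  have hg := hg.comp hσ
  set u := signVec (s ∘ toLast s) ∘ σ
  have h02 := hg (i := 0) (j := 2) (by decide) (by decide) (by decide)
  have h01 := hg (i := 0) (j := 1) (by decide) (by decide) (by decide)
  have hu : u 1 ≠ 0 := fun h => h01 (by simp [h, br])
  exact fun h => h _ ((jacSign_mForm_three_iff hu _).2 (mul_self_pos.2 h02))

lemma jacNeutral_tri {e : Equiv.Perm (Fin 4)} (he : e (zeroPos s) = 1) :
    JacNeutral (perm e (rep .tri s)) := by
  rw [perm_rep_tri_eq, he]
  exact jacNeutral_mForm_one _

lemma forall_jacNeutral_iff {κ : Kind} (hs : Valid κ s) :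
    (∀ e : Equiv.Perm (Fin 4), JacNeutral (perm e.symm (rep κ s))) ↔
      κ = .w ∨ κ = .ghz ∨ κ = .re := by
  cases κ
  case w => simp [perm_symm_rep, jacNeutral_w]
  case ghz => simpa [perm_symm_rep] using fun e => jacNeutral_ghz (hs.comp e)
  case re => simpa [perm_symm_rep] using fun e => jacNeutral_re (hs.comp e)
  case pair =>
    have key : ∀ s, Valid .pair s → ∃ e : Equiv.Perm (Fin 4),
        s (e 0) = 0 ∧ s (e 1) ≠ 0 ∧ s (e 2) ≠ 0 ∧ s (e 3) = 0 := by decide +kernel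
    obtain ⟨e, h0, h1, h2, h3⟩ := key s hs
    simpa [perm_symm_rep] using ⟨e, not_jacNeutral_pair (s := s ∘ e) h0 h1 h2 h3⟩
  case cross =>
    have key : ∀ s, Valid .cross s → ∃ e : Equiv.Perm (Fin 4),
        s (e 0) = 0 ∧ s (e 1) ≠ 0 ∧ s (e 2) ≠ 0 ∧ s (e 3) ≠ 0 := by decide +kernel
    obtain ⟨e, h0, h1, h2, h3⟩ := key s hs
    simpa [perm_symm_rep] using ⟨e, not_jacNeutral_cross (s := s ∘ e) h0 h1 h2 h3⟩
  case tri =>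
    simpa using ⟨Equiv.swap 3 (zeroPos s), not_jacNeutral_tri hs (by simp)⟩

lemma pairSign_w_iff (ε : ℝ) : PairSign ε (rep .w s) ↔ 0 < ε * ((-(s 0 * s 1) : SignType) : ℝ) := by
  constructor
  · rintro ⟨x, y, h⟩
    rw [pairDet_w, ← mul_assoc] at h
    simpa using pos_of_mul_pos_left h (sq_nonneg _)
  · intro h
    exact ⟨![1, 0], ![1, 0], by simpa [pairDet_w] using h⟩

lemma pairSign_ghz (h0 : s 0 = 0) (h1 : s 1 = 0) (h2 : s 2 = 0) (h3 : s 3 ≠ 0) {ε : ℝ}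
    (hε : ε ≠ 0) : PairSign ε (rep .ghz s) :=
  ⟨![1, ε], ![1, 0], by simpa [pairDet_ghz_three h0 h1 h2 h3] using mul_self_pos.2 hε⟩

lemma mul_eq_of_valid_re : ∀ s, Valid .re s →
    (s 3 = 0 → s 0 * s 1 = -s 2) ∧ (s 2 = 0 → s 0 * s 1 = -s 3) := by
  decide +kernel

lemma pairDet_re (hs : Valid .re s) (h0 : s 0 ≠ 0) (h1 : s 1 ≠ 0) (h2 : s 2 ≠ 0) (h3 : s 3 = 0)
    (x y : Fin 2 → ℝ) : pairDet (rep .re s) x y = s 2 * ((x 0 ^ 2 + x 1 ^ 2) * y 0 ^ 2) := by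
  have h : (s 0 : ℝ) * (s 1 : ℝ) = -(s 2 : ℝ) := by
    exact_mod_cast congr_arg (fun a : SignType => (a : ℝ)) ((mul_eq_of_valid_re s hs).1 h3)
  rw [pairDet_re_three h0 h1 h2 h3, h]
  ring

lemma pairSign_re_iff (hs : Valid .re s) (h0 : s 0 ≠ 0) (h1 : s 1 ≠ 0) (h2 : s 2 ≠ 0)
    (h3 : s 3 = 0) (ε : ℝ) : PairSign ε (rep .re s) ↔ 0 < ε * (s 2 : ℝ) := by
  constructor
  · rintro ⟨x, y, h⟩
    rw [pairDet_re hs h0 h1 h2 h3, ← mul_assoc] at h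
    exact pos_of_mul_pos_left h (by positivity)
  · intro h
    exact ⟨![1, 0], ![1, 0], by simpa [pairDet_re hs h0 h1 h2 h3] using h⟩

lemma not_pairSign_re (hs : Valid .re s) (h : PairSign 1 (rep .re s)) :
    ¬ PairSign (-1) (rep .re s) := by
  have key : ∀ s, Valid .re s → (s 0 = 0 ∨ s 1 = 0) ∨
      (s 0 ≠ 0 ∧ s 1 ≠ 0 ∧ s 2 ≠ 0 ∧ s 3 = 0) ∨ (s 0 ≠ 0 ∧ s 1 ≠ 0 ∧ s 2 = 0 ∧ s 3 ≠ 0) := by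
    decide +kernel
  obtain ⟨x, y, h⟩ := h
  rintro ⟨z, w, h'⟩
  rcases key s hs with h0 | ⟨h0, h1, h2, h3⟩ | ⟨h0, h1, h2, h3⟩
  · simp [pairDet_re_eq_zero h0] at h
  · rw [pairDet_re hs h0 h1 h2 h3, ← mul_assoc] at h h'
    have := pos_of_mul_pos_left h (by positivity)
    have := pos_of_mul_pos_left h' (by positivity)
    linarith
  · have hm : (s 0 : ℝ) * (s 1 : ℝ) = -(s 3 : ℝ) := by
      exact_mod_cast congr_arg (fun a : SignType => (a : ℝ)) ((mul_eq_of_valid_re s hs).2 h2)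
    have hd : ∀ x y, pairDet (rep .re s) x y = s 3 * ((y 0 ^ 2 + y 1 ^ 2) * x 0 ^ 2) := by
      intro x y
      rw [pairDet_re_two h0 h1 h2 h3, hm]
      ring
    rw [hd, ← mul_assoc] at h h'
    have := pos_of_mul_pos_left h (by positivity)
    have := pos_of_mul_pos_left h' (by positivity)
    linarith

lemma exists_ghz_last : ∀ s, Valid .ghz s → ∃ e : Equiv.Perm (Fin 4),
    s (e 0) = 0 ∧ s (e 1) = 0 ∧ s (e 2) = 0 ∧ s (e 3) ≠ 0 := by
  decide +kernel

lemma not_equ_ghz_w (hs : Valid .ghz s) : ¬ Equ (rep .ghz s) (rep .w s') := fun h => by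
  obtain ⟨e, h0, h1, h2, h3⟩ := exists_ghz_last s hs
  have h := h.rep_comp (by decide) (by decide) e
  have hp := (pairSign_w_iff 1).1 (h.symm.pairSign (pairSign_ghz h0 h1 h2 h3 one_ne_zero))
  have hn := (pairSign_w_iff (-1)).1
    (h.symm.pairSign (pairSign_ghz h0 h1 h2 h3 (neg_ne_zero.2 one_ne_zero)))
  linarith

lemma not_equ_ghz_re (hs : Valid .ghz s) (hs' : Valid .re s') :
    ¬ Equ (rep .ghz s) (rep .re s') := fun h => by
  obtain ⟨e, h0, h1, h2, h3⟩ := exists_ghz_last s hs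
  have h := h.rep_comp (by decide) (by decide) e
  exact not_pairSign_re (hs'.comp e) (h.symm.pairSign (pairSign_ghz h0 h1 h2 h3 one_ne_zero))
    (h.symm.pairSign (pairSign_ghz h0 h1 h2 h3 (neg_ne_zero.2 one_ne_zero)))

lemma exists_re_last : ∀ s, Valid .re s → ∃ e : Equiv.Perm (Fin 4),
    s (e 0) ≠ 0 ∧ s (e 1) ≠ 0 ∧ s (e 2) ≠ 0 ∧ s (e 3) = 0 := by
  decide +kernel

lemma not_equ_re_w (hs : Valid .re s) : ¬ Equ (rep .re s) (rep .w s') := fun h => by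
  obtain ⟨e, h0, h1, h2, h3⟩ := exists_re_last s hs
  have h := h.rep_comp (by decide) (by decide) e
  obtain ⟨y, hy⟩ := h.symm.pairAnisotropic ⟨![1, 0], fun x hx => by
    rw [pairDet_re (hs.comp e) h0 h1 h2 h3]
    have h2' : (s (e 2) : ℝ) ≠ 0 := signType_cast_eq_zero.not.2 h2
    have hx' : x 0 ^ 2 + x 1 ^ 2 ≠ 0 := by
      intro hn
      have e0 : x 0 = 0 := by nlinarith [sq_nonneg (x 0), sq_nonneg (x 1)]
      have e1 : x 1 = 0 := by nlinarith [sq_nonneg (x 0), sq_nonneg (x 1)]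
      exact hx (funext fun i => by fin_cases i <;> simpa)
    simpa using ⟨h2', hx'⟩⟩
  refine hy ![0, 1] (fun h0 => by simpa using congr_fun h0 1) ?_
  simp [pairDet_w]

lemma not_equ_pair_tri (hs : Valid .pair s) (hs' : Valid .tri s') :
    ¬ Equ (rep .pair s) (rep .tri s') := fun h => by
  have key : ∀ s, Valid .pair s → ∀ f : Fin 4, ∃ e : Equiv.Perm (Fin 4),
      (s (e 0) = 0 ∧ s (e 1) ≠ 0 ∧ s (e 2) ≠ 0 ∧ s (e 3) = 0 ∧ f = e 1) ∨
      (s (e 0) ≠ 0 ∧ s (e 1) = 0 ∧ s (e 2) ≠ 0 ∧ s (e 3) = 0 ∧ f = e 3) := by decide +kernel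
  obtain ⟨e, he⟩ := key s hs (zeroPos s')
  have h := h.perm e.symm
  rw [perm_symm_rep (by decide)] at h
  rcases he with ⟨h0, h1, h2, h3, hf⟩ | ⟨h0, h1, h2, h3, hf⟩
  · exact not_jacNeutral_pair (s := s ∘ e) h0 h1 h2 h3
      (h.jacNeutral (jacNeutral_tri (by simp [hf])))
  · exact not_jacNeutral_tri hs' (by simp [hf])
      (h.symm.jacNeutral (jacNeutral_pair_zero_two h0 h1 h2 h3))

lemma not_equ_cross_tri (hs : Valid .cross s) (hs' : Valid .tri s') :
    ¬ Equ (rep .cross s) (rep .tri s') := fun h => by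
  have key : ∀ s, Valid .cross s → ∀ f : Fin 4, ∃ e : Equiv.Perm (Fin 4),
      (s (e 0) = 0 ∧ s (e 1) ≠ 0 ∧ s (e 2) ≠ 0 ∧ s (e 3) ≠ 0 ∧ f = e 1) ∨
      (s (e 0) ≠ 0 ∧ s (e 1) ≠ 0 ∧ s (e 2) ≠ 0 ∧ s (e 3) = 0 ∧ f = e 3) := by decide +kernel
  obtain ⟨e, he⟩ := key s hs (zeroPos s')
  have h := h.perm e.symm
  rw [perm_symm_rep (by decide)] at h
  rcases he with ⟨h0, h1, h2, h3, hf⟩ | ⟨h0, h1, h2, h3, hf⟩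
  · exact not_jacNeutral_cross (s := s ∘ e) h0 h1 h2 h3
      (h.jacNeutral (jacNeutral_tri (by simp [hf])))
  · exact not_jacNeutral_tri hs' (by simp [hf])
      (h.symm.jacNeutral (jacNeutral_cross_three h0 h1 h2 h3))

lemma not_equ_pair_cross (hs : Valid .pair s) (hs' : Valid .cross s') :
    ¬ Equ (rep .pair s) (rep .cross s') := fun h => by
  have key : ∀ s, Valid .pair s → ∀ s', Valid .cross s' → ∃ e : Equiv.Perm (Fin 4),
      (s (e 0) = 0 ∧ s (e 1) ≠ 0 ∧ s (e 2) ≠ 0 ∧ s (e 3) = 0) ∧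
      ((s' (e 0) ≠ 0 ∧ s' (e 1) = 0 ∧ s' (e 2) ≠ 0 ∧ s' (e 3) ≠ 0) ∨
        (s' (e 0) ≠ 0 ∧ s' (e 1) ≠ 0 ∧ s' (e 2) ≠ 0 ∧ s' (e 3) = 0)) := by decide +kernel
  obtain ⟨e, ⟨h0, h1, h2, h3⟩, he⟩ := key s hs s' hs'
  have h := h.rep_comp (by decide) (by decide) e
  refine not_jacNeutral_pair (s := s ∘ e) h0 h1 h2 h3 (h.jacNeutral ?_)
  rcases he with ⟨h0, h1, h2, h3⟩ | ⟨h0, h1, h2, h3⟩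
  · exact jacNeutral_cross_one h0 h1 h2 h3
  · exact jacNeutral_cross_three h0 h1 h2 h3

/-! ### The labels of the orbits -/

/-- The sign vectors that label pairwise inequivalent normal forms of a given kind. -/
def Normal : Kind → (Fin 4 → SignType) → Prop
  | .w, s => (∃ k, s k = 1 ∧ ∀ j < k, s j = 0) ∧ (numNonzero s = 1 → s = ![1, 0, 0, 0])
  | .ghz, s => ∀ k, s k ≠ -1
  | _, _ => True

instance (κ : Kind) (s : Fin 4 → SignType) : Decidable (Normal κ s) := by
  cases κ <;> unfold Normal <;> infer_instance

/-- The labels of the nilpotent orbits. -/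
def labels : Finset (Kind × (Fin 4 → SignType)) :=
  Finset.univ.filter fun p => Valid p.1 p.2 ∧ Normal p.1 p.2

lemma card_labels : labels.card = 145 := by decide +kernel

lemma mem_labels {p : Kind × (Fin 4 → SignType)} :
    p ∈ labels ↔ Valid p.1 p.2 ∧ Normal p.1 p.2 := by
  simp [labels]

lemma eq_of_equ_w (hs : Valid .w s) (hn : Normal .w s) (hs' : Valid .w s') (hn' : Normal .w s')
    (h : Equ (rep .w s) (rep .w s')) : s = s' := by
  have key : ∀ s, Valid .w s ∧ Normal .w s → ∀ s', Valid .w s' ∧ Normal .w s' →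
      (∀ i j, i ≠ j → s i * s j = s' i * s' j) → s = s' := by decide +kernel
  refine key s ⟨hs, hn⟩ s' ⟨hs', hn'⟩ fun i j hij => ?_
  have he : ∀ i j : Fin 4, i ≠ j → ∃ e : Equiv.Perm (Fin 4), e 0 = i ∧ e 1 = j := by
    decide +kernel
  obtain ⟨e, rfl, rfl⟩ := he i j hij
  have h := h.rep_comp (by decide) (by decide) e
  refine neg_injective (signType_eq_of_pos_iff fun ε => ?_)
  exact (pairSign_w_iff ε).symm.trans ((h.pairSign_iff ε).trans (pairSign_w_iff ε))

lemma eq_of_equ_ghz (hs : Valid .ghz s) (hn : Normal .ghz s) (hs' : Valid .ghz s')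
    (hn' : Normal .ghz s') (h : Equ (rep .ghz s) (rep .ghz s')) : s = s' := by
  have key : ∀ s, Valid .ghz s ∧ Normal .ghz s → ∀ s', Valid .ghz s' ∧ Normal .ghz s' →
      s ≠ s' → ∃ e : Equiv.Perm (Fin 4),
        s (e 0) = 0 ∧ s (e 1) = 0 ∧ s (e 2) = 0 ∧ s (e 3) ≠ 0 ∧ s' (e 0) ≠ 0 := by decide +kernel
  by_contra hne
  obtain ⟨e, h0, h1, h2, h3, h'⟩ := key s ⟨hs, hn⟩ s' ⟨hs', hn'⟩ hne
  have h := h.rep_comp (by decide) (by decide) e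
  obtain ⟨x, y, hxy⟩ := h.symm.pairSign (pairSign_ghz h0 h1 h2 h3 one_ne_zero)
  rw [pairDet_ghz_eq_zero (.inl h')] at hxy
  simp at hxy

lemma eq_of_equ_re (hs : Valid .re s) (hs' : Valid .re s') (h : Equ (rep .re s) (rep .re s')) :
    s = s' := by
  have key : ∀ s, Valid .re s → ∀ s', Valid .re s' → s ≠ s' → ∃ e : Equiv.Perm (Fin 4),
      (s (e 0) ≠ 0 ∧ s (e 1) ≠ 0 ∧ s (e 2) ≠ 0 ∧ s (e 3) = 0) ∧
      (s' (e 0) = 0 ∨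
        (s' (e 0) ≠ 0 ∧ s' (e 1) ≠ 0 ∧ s' (e 2) ≠ 0 ∧ s' (e 3) = 0 ∧ s (e 2) ≠ s' (e 2))) := by
    decide +kernel
  by_contra hne
  obtain ⟨e, ⟨h0, h1, h2, h3⟩, he⟩ := key s hs s' hs' hne
  have h := h.rep_comp (by decide) (by decide) e
  have hp := pairSign_re_iff (hs.comp e) h0 h1 h2 h3
  rcases he with h0' | ⟨h0', h1', h2', h3', hne⟩
  · obtain ⟨x, y, hxy⟩ := h.symm.pairSign ((hp _).2 (jacSign_self h2))
    rw [pairDet_re_eq_zero (.inl h0')] at hxy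
    simp at hxy
  · refine hne (signType_eq_of_pos_iff fun ε => ?_)
    exact (hp ε).symm.trans
      ((h.pairSign_iff ε).trans (pairSign_re_iff (hs'.comp e) h0' h1' h2' h3' ε))

lemma eq_of_equ_pair (hs : Valid .pair s) (hs' : Valid .pair s')
    (h : Equ (rep .pair s) (rep .pair s')) : s = s' := by
  have key : ∀ s, Valid .pair s → ∀ s', Valid .pair s' → s ≠ s' → ∃ e : Equiv.Perm (Fin 4),
      (s (e 0) = 0 ∧ s (e 1) ≠ 0 ∧ s (e 2) ≠ 0 ∧ s (e 3) = 0) ∧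
      ((s' (e 0) = 0 ∧ s' (e 1) ≠ 0 ∧ s' (e 2) ≠ 0 ∧ s' (e 3) = 0 ∧ s (e 2) ≠ s' (e 2)) ∨
        (s' (e 0) ≠ 0 ∧ s' (e 1) = 0 ∧ s' (e 2) = 0 ∧ s' (e 3) ≠ 0) ∨
        (s' (e 0) = 0 ∧ s' (e 1) ≠ 0 ∧ s' (e 2) = 0 ∧ s' (e 3) ≠ 0)) := by
    decide +kernel
  by_contra hne
  obtain ⟨e, ⟨h0, h1, h2, h3⟩, he⟩ := key s hs s' hs' hne
  have h := h.rep_comp (by decide) (by decide) e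
  rcases he with ⟨h0', h1', h2', h3', hne⟩ | ⟨h0', h1', h2', h3'⟩ | ⟨h0', h1', h2', h3'⟩
  · refine hne (neg_injective (signType_eq_of_pos_iff fun ε => ?_))
    simpa using (jacSign_pair_iff h0 h1 h2 h3 ε).symm.trans
      ((h.jacSign_iff ε).trans (jacSign_pair_iff h0' h1' h2' h3' ε))
  · exact not_jacNeutral_pair (s := s ∘ e) h0 h1 h2 h3
      (h.jacNeutral (jacNeutral_pair_zero_three h0' h1' h2' h3'))
  · exact not_jacNeutral_pair (s := s ∘ e) h0 h1 h2 h3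
      (h.jacNeutral (jacNeutral_pair_one_three h0' h1' h2' h3'))

lemma eq_of_equ_cross (hs : Valid .cross s) (hs' : Valid .cross s')
    (h : Equ (rep .cross s) (rep .cross s')) : s = s' := by
  have key : ∀ s, Valid .cross s → ∀ s', Valid .cross s' → s ≠ s' → ∃ e : Equiv.Perm (Fin 4),
      (s (e 0) = 0 ∧ s (e 1) ≠ 0 ∧ s (e 2) ≠ 0 ∧ s (e 3) ≠ 0) ∧
      ((s' (e 0) = 0 ∧ s' (e 1) ≠ 0 ∧ s' (e 2) ≠ 0 ∧ s' (e 3) ≠ 0 ∧ s (e 1) ≠ s' (e 1)) ∨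
        (s' (e 0) ≠ 0 ∧ s' (e 1) ≠ 0 ∧ s' (e 2) ≠ 0 ∧ s' (e 3) = 0)) := by
    decide +kernel
  by_contra hne
  obtain ⟨e, ⟨h0, h1, h2, h3⟩, he⟩ := key s hs s' hs' hne
  have h := h.rep_comp (by decide) (by decide) e
  rcases he with ⟨h0', h1', h2', h3', hne⟩ | ⟨h0', h1', h2', h3'⟩
  · refine hne (signType_eq_of_pos_iff fun ε => ?_)
    exact (jacSign_cross_iff h0 h1 h2 h3 ε).symm.trans
      ((h.jacSign_iff ε).trans (jacSign_cross_iff h0' h1' h2' h3' ε))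
  · exact not_jacNeutral_cross (s := s ∘ e) h0 h1 h2 h3
      (h.jacNeutral (jacNeutral_cross_three h0' h1' h2' h3'))

lemma zeroPos_eq_of_equ (hs : Valid .tri s) (h : Equ (rep .tri s) (rep .tri s')) :
    zeroPos s = zeroPos s' := by
  by_contra hne
  have he : ∀ i j : Fin 4, i ≠ j → ∃ e : Equiv.Perm (Fin 4), e i = 3 ∧ e j = 1 := by
    decide +kernel
  obtain ⟨e, h3, h1⟩ := he _ _ hne
  exact not_jacNeutral_tri hs h3 ((h.perm e).jacNeutral (jacNeutral_tri h1))

lemma br_eq_of_equ {a b : Fin 4 → SignType} (ha : Generic (signVec a)) (hb : Generic (signVec b))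
    (h : Equ (mForm 3 (signVec a)) (mForm 3 (signVec b))) {e : Equiv.Perm (Fin 4)} (he : e 3 = 3)
    (ε : ℝ) : 0 < ε * br (signVec a (e 0)) (signVec a (e 2)) ↔
      0 < ε * br (signVec b (e 0)) (signVec b (e 2)) := by
  have h := h.perm e.symm
  rw [perm_mForm, perm_mForm, Equiv.symm_symm, e.symm_apply_eq.2 he.symm] at h
  have hne : ∀ u : Fin 4 → Fin 2 → ℝ, Generic u → (u ∘ e) 1 ≠ 0 := fun u hu h1 =>
    hu.comp he (i := 0) (j := 1) (by decide) (by decide) (by decide) (by rw [h1]; simp [br])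
  exact (jacSign_mForm_three_iff (hne _ ha) ε).symm.trans
    ((h.jacSign_iff ε).trans (jacSign_mForm_three_iff (hne _ hb) ε))

lemma eq_of_equ_mForm {a b : Fin 4 → SignType} (ha : a 0 ≠ 0 ∧ a 1 ≠ 0 ∧ a 2 ≠ 0 ∧ a 3 = 0)
    (hb : b 0 ≠ 0 ∧ b 1 ≠ 0 ∧ b 2 ≠ 0 ∧ b 3 = 0)
    (h : Equ (mForm 3 (signVec a)) (mForm 3 (signVec b))) : a = b := by
  have hg := @br_eq_of_equ a b (generic_signVec ha.1 ha.2.1 ha.2.2.1)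
    (generic_signVec hb.1 hb.2.1 hb.2.2.1) h
  have h0 : a 0 = b 0 := signType_eq_of_pos_iff fun ε => by
    simpa [br, signVec, Equiv.swap_apply_of_ne_of_ne] using hg (e := Equiv.swap 1 2) (by decide) ε
  have h2 : a 2 = b 2 := signType_eq_of_pos_iff fun ε => by
    simpa [br, signVec] using hg (e := 1) (by decide) ε
  have h01 : -(a 0 * a 1) = -(b 0 * b 1) := signType_eq_of_pos_iff fun ε => by
    simpa [br, signVec, Equiv.swap_apply_of_ne_of_ne] using hg (e := Equiv.swap 0 1) (by decide) ε
  have key : ∀ p q r : SignType, p ≠ 0 → -(p * q) = -(p * r) → q = r := by decide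
  have h1 := key _ _ _ ha.1 (h01.trans (by rw [h0]))
  ext k
  fin_cases k
  exacts [by simp [h0], by simp [h1], by simp [h2], by simp [ha.2.2.2, hb.2.2.2]]

lemma eq_of_equ_tri (hs : Valid .tri s) (hs' : Valid .tri s')
    (h : Equ (rep .tri s) (rep .tri s')) : s = s' := by
  have hl : toLast s' = toLast s := by rw [toLast, toLast, zeroPos_eq_of_equ hs h]
  have h' := valid_tri_toLast s' hs'
  rw [hl] at h'
  have := eq_of_equ_mForm (a := s ∘ toLast s) (b := s' ∘ toLast s) (valid_tri_toLast s hs) h'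
    (by
      have := h.perm (toLast s)⁻¹
      rwa [rep, rep, hl, perm_perm, perm_perm, inv_mul_cancel, perm_one, perm_one] at this)
  exact (toLast s).surjective.injective_comp_right this

lemma eq_of_equ {κ κ' : Kind} (hs : Valid κ s) (hn : Normal κ s) (hs' : Valid κ' s')
    (hn' : Normal κ' s') (h : Equ (rep κ s) (rep κ' s')) : (κ, s) = (κ', s') := by
  have hc : (κ = .w ∨ κ = .ghz ∨ κ = .re) ↔ (κ' = .w ∨ κ' = .ghz ∨ κ' = .re) := by
    rw [← forall_jacNeutral_iff hs, ← forall_jacNeutral_iff hs']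
    exact forall_congr' fun e => ⟨(h.symm.perm _).jacNeutral, (h.perm _).jacNeutral⟩
  cases κ <;> cases κ' <;> simp only [reduceCtorEq, or_false, or_true, or_self, iff_false,
    false_iff, not_true_eq_false, Prod.mk.injEq, true_and, false_and] at hc ⊢
  · exact eq_of_equ_w hs hn hs' hn' h
  · exact not_equ_ghz_w hs' h.symm
  · exact not_equ_re_w hs' h.symm
  · exact not_equ_ghz_w hs h
  · exact eq_of_equ_ghz hs hn hs' hn' h
  · exact not_equ_ghz_re hs hs' h
  · exact not_equ_re_w hs h
  · exact not_equ_ghz_re hs' hs h.symm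
  · exact eq_of_equ_re hs hs' h
  · exact eq_of_equ_pair hs hs' h
  · exact not_equ_pair_tri hs hs' h
  · exact not_equ_pair_cross hs hs' h
  · exact not_equ_pair_tri hs' hs h.symm
  · exact eq_of_equ_tri hs hs' h
  · exact not_equ_cross_tri hs' hs h.symm
  · exact not_equ_pair_cross hs' hs h.symm
  · exact not_equ_cross_tri hs hs' h
  · exact eq_of_equ_cross hs hs' h

/-! ### Reduction to labels -/

lemma equ_single {k : Fin 4} {ε : ℝ} (hε : ε ^ 2 = 1) :
    Equ (wForm fun j => if j = k then ε else 0) (unitForm fun _ => False) := by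
  have hd : (0 : ℝ) * 0 - ε * -ε = 1 := by linear_combination hε
  fin_cases k
  · refine (equ_fst _ hd).trans (.of_eq (ext_fin_two ?_))
    simp [wForm, unitForm, ofCoord, Fin.sum_univ_four, Fin.forall_fin_succ, ← sq, hε]
  · refine (equ_snd _ hd).trans (.of_eq (ext_fin_two ?_))
    simp [wForm, unitForm, ofCoord, Fin.sum_univ_four, Fin.forall_fin_succ, ← sq, hε]
  · refine (equ_trd _ hd).trans (.of_eq (ext_fin_two ?_))
    simp [wForm, unitForm, ofCoord, Fin.sum_univ_four, Fin.forall_fin_succ, ← sq, hε]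
  · refine (equ_fth _ hd).trans (.of_eq (ext_fin_two ?_))
    simp [wForm, unitForm, ofCoord, Fin.sum_univ_four, Fin.forall_fin_succ, ← sq, hε]

lemma neg_rep_w (s : Fin 4 → SignType) : -rep .w s = rep .w (-s) := by
  refine ext_fin_two ?_
  simp [rep, wForm, ofCoord, Fin.sum_univ_four, Fin.forall_fin_succ]

lemma exists_normal_w (hs : Valid .w s) :
    ∃ s', Valid .w s' ∧ Normal .w s' ∧ Equ (rep .w s) (rep .w s') := by
  have key : ∀ s, Valid .w s → (∃ k, s k ≠ 0 ∧ ∀ j, s j = if j = k then s k else 0) ∨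
      Normal .w s ∨ Normal .w (-s) := by
    decide +kernel
  rcases key s hs with ⟨k, hk, hj⟩ | hn | hn
  · have hr : ∀ {s : Fin 4 → SignType} {k}, s k ≠ 0 → (∀ j, s j = if j = k then s k else 0) →
        Equ (rep .w s) (unitForm fun _ => False) := fun {s k} hk hj => by
      have hc : (fun j => (s j : ℝ)) = fun j => if j = k then (s k : ℝ) else 0 := by
        ext j
        rw [hj j]
        split_ifs <;> simp
      rw [rep, hc]
      exact equ_single (sq_signType hk)
    exact ⟨![1, 0, 0, 0], by decide, by decide, (hr hk hj).trans (hr (k := 0) (by decide)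
      (by decide)).symm⟩
  · exact ⟨s, hs, hn, .refl _⟩
  · refine ⟨-s, ?_, hn, neg_rep_w s ▸ equ_neg _⟩
    simpa [Valid, numNonzero] using hs

lemma exists_normal_ghz (hs : Valid .ghz s) :
    ∃ s', Valid .ghz s' ∧ Normal .ghz s' ∧ Equ (rep .ghz s) (rep .ghz s') := by
  refine ⟨fun j => if s j = 0 then 0 else 1, ?_, fun k => ?_, .of_eq ?_⟩
  · simpa [Valid, numNonzero] using hs
  · dsimp only
    split_ifs <;> decide
  · have : ∀ j, (if s j = 0 then (0 : SignType) else 1) = 0 ↔ s j = 0 := fun j => by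
      split_ifs with h <;> simp [h]
    simp only [rep, unitForm, this]

lemma exists_normal {κ : Kind} (hs : Valid κ s) :
    ∃ s', Valid κ s' ∧ Normal κ s' ∧ Equ (rep κ s) (rep κ s') := by
  cases κ
  case w => exact exists_normal_w hs
  case ghz => exact exists_normal_ghz hs
  all_goals exact ⟨s, hs, trivial, .refl _⟩

lemma not_pairSign_zero (ε : ℝ) : ¬ PairSign ε 0 := by
  rintro ⟨x, y, h⟩
  simp [pairDet, det_fin_two] at h

lemma jacNeutral_zero : JacNeutral 0 := by
  rintro ε ⟨x, h⟩
  simp [jac, polar, rotate, pairDet] at h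

lemma coord_rep_w (s : Fin 4 → SignType) (k : Fin 4) :
    coord (rep .w s) (fun j => if j = k then 1 else 0) = s k := by
  rw [rep, wForm, coord_ofCoord, Finset.sum_eq_single k] <;> simp +contextual [eq_comm]

lemma rep_ne_zero {κ : Kind} (hs : Valid κ s) : rep κ s ≠ 0 := fun h => by
  have hp : ∀ e, perm e 0 = 0 := fun e => rfl
  have hc (e : Equiv.Perm (Fin 4)) (hκ : κ ≠ .tri) : rep κ (s ∘ e) = 0 := by
    rw [← perm_symm_rep hκ, h, hp]
  cases κ
  case w =>
    have key : ∀ s, Valid .w s → ∃ k, s k ≠ 0 := by decide +kernel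
    obtain ⟨k, hk⟩ := key s hs
    refine signType_cast_eq_zero.not.2 hk ?_
    rw [← coord_rep_w, h]
    rfl
  case ghz =>
    obtain ⟨e, h0, h1, h2, h3⟩ := exists_ghz_last s hs
    refine not_pairSign_zero 1 ?_
    rw [← hc e (by decide)]
    exact pairSign_ghz h0 h1 h2 h3 one_ne_zero
  case re =>
    obtain ⟨e, h0, h1, h2, h3⟩ := exists_re_last s hs
    refine not_pairSign_zero (s (e 2)) ?_
    rw [← hc e (by decide)]
    exact (pairSign_re_iff (hs.comp e) h0 h1 h2 h3 _).2 (jacSign_self h2)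
  all_goals
    have := (forall_jacNeutral_iff hs).1 fun e => by
      rw [h, hp]
      exact jacNeutral_zero
    simp at this

end Hypermatrix

open Hypermatrix in
/-- The set of nonzero nilpotent hypermatrices (nonzero `T` with `0` in the closure of the
`G`-orbit of `T`) is a union of `G`-orbits, and it decomposes into exactly 145 distinct
`G`-orbits. -/
theorem nilpotent_orbits_real :
    (∀ T : V, (T ≠ 0 ∧ (0 : V) ∈ closure (orbitG T)) → ∀ g : G,
      (actG g T ≠ 0 ∧ (0 : V) ∈ closure (orbitG (actG g T)))) ∧
    Set.ncard {O : Set V | ∃ T : V, T ≠ 0 ∧ (0 : V) ∈ closure (orbitG T) ∧ O = orbitG T}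
      = 145 := by
  constructor
  · rintro T ⟨hT, h⟩ g
    have hg : Equ T (actG g T) := ⟨g, rfl⟩
    exact ⟨hg.ne_zero hT, orbitG_eq_iff.2 hg ▸ h⟩
  · have himage : {O : Set V | ∃ T : V, T ≠ 0 ∧ (0 : V) ∈ closure (orbitG T) ∧ O = orbitG T} =
        (fun p : Kind × (Fin 4 → SignType) => orbitG (rep p.1 p.2)) '' labels := by
      ext O
      constructor
      · rintro ⟨T, hT, h, rfl⟩
        obtain ⟨κ, s, hs, hTs⟩ := good_of_mem_closure hT h
        obtain ⟨s', hs', hn, hss⟩ := exists_normal hs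
        exact ⟨(κ, s'), mem_labels.2 ⟨hs', hn⟩, orbitG_eq_iff.2 (hTs.trans hss).symm⟩
      · rintro ⟨⟨κ, s⟩, hp, rfl⟩
        have hs := (mem_labels.1 hp).1
        exact ⟨_, rep_ne_zero hs, (unstable_rep hs).zero_mem_closure, rfl⟩
    rw [himage, Set.InjOn.ncard_image, Set.ncard_coe_finset, card_labels]
    rintro ⟨κ, s⟩ hp ⟨κ', s'⟩ hp' h
    obtain ⟨hs, hn⟩ := mem_labels.1 hp
    obtain ⟨hs', hn'⟩ := mem_labels.1 hp'
    exact eq_of_equ hs hn hs' hn' (orbitG_eq_iff.1 h)
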